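/- arXiv:math/0703898 — 3 statements merged into one kernel-verified Lean document; each statement's English description precedes it below -/
import Mathlib

section
/- For every canonical sequence τ of a partition, every k ≥ 2, and all integers p, q ≥ 0: the pattern 12⋯k(τ+k)2ᵖ12^q is equivalent to the pattern 12⋯k(τ+k)2^{p+q}1, and the pattern 12⋯k2ᵖ12^q(τ+k) is equivalent to the pattern 12⋯k2^{p+q}1(τ+k). -/
/-- `π` is the canonical sequence of a set partition: every entry is at least 1,
and each entry is at most one more than the maximum of the preceding entries
(so the first entry is 1). -/
def IsCanonicalSeq (π : List ℕ) : Prop :=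
  ∀ i (h : i < π.length), 1 ≤ π.get ⟨i, h⟩ ∧ π.get ⟨i, h⟩ ≤ (π.take i).foldr max 0 + 1

/-- `π` contains the pattern `σ`: there is a subsequence of `π`
order-isomorphic to `σ`. -/
def ContainsPat (π σ : List ℕ) : Prop :=
  ∃ f : Fin σ.length → Fin π.length, StrictMono f ∧
    ∀ i j : Fin σ.length, σ.get i < σ.get j ↔ π.get (f i) < π.get (f j)

/-- `π` avoids the pattern `σ`. -/
def AvoidsPat (π σ : List ℕ) : Prop := ¬ ContainsPat π σ

/-- `pAvoid n σ` is the number of canonical sequences of partitions of `[n]`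
avoiding the pattern `σ`. -/
noncomputable def pAvoid (n : ℕ) (σ : List ℕ) : ℕ :=
  Set.ncard {π : List ℕ | π.length = n ∧ IsCanonicalSeq π ∧ AvoidsPat π σ}

/-- Two patterns are equivalent if they have the same number of avoiders of
each size. -/
def PatEquiv (σ σ' : List ℕ) : Prop := ∀ n, pAvoid n σ = pAvoid n σ'

/-- The increasing sequence `1, 2, …, k`. -/
def iota (k : ℕ) : List ℕ := (List.range k).map (· + 1)

/-! ### Sequences assembled from a mask -/

/-- Interleave `a` and `b` following the mask `m`: `true` takes the next entry of `a`,
`false` the next entry of `b`. -/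
def weave {α : Type*} : List Bool → List α → List α → List α
  | [], _, _ => []
  | true :: m, x :: a, b => x :: weave m a b
  | false :: m, a, x :: b => x :: weave m a b
  | true :: _, [], _ => []
  | false :: _, _, [] => []

theorem weave_map_filter {α : Type*} (P : α → Bool) (v : List α) :
    weave (v.map P) (v.filter P) (v.filter (fun x => !P x)) = v := by
  induction v with
  | nil => rfl
  | cons x v ih => cases h : P x <;> simp [h, weave, ih]

theorem map_weave {α β : Type*} (g : α → β) (m : List Bool) (a b : List α) :
    (weave m a b).map g = weave m (a.map g) (b.map g) := by
  induction m generalizing a b with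
  | nil => rfl
  | cons x m ih =>
    cases x
    · cases b <;> simp [weave, ih]
    · cases a <;> simp [weave, ih]

theorem weave_spec {α : Type*} (P : α → Bool) (m : List Bool) (a b : List α)
    (ha : m.count true = a.length) (hb : m.count false = b.length)
    (hPa : ∀ x ∈ a, P x = true) (hPb : ∀ x ∈ b, P x = false) :
    (weave m a b).map P = m ∧ (weave m a b).filter P = a ∧
      (weave m a b).filter (fun x => !P x) = b := by
  induction m generalizing a b with
  | nil =>
    have ha' : a = [] := by simpa using ha.symm
    have hb' : b = [] := by simpa using hb.symm
    simp [weave, ha', hb']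
  | cons x m ih =>
    cases x
    · cases b with
      | nil => simp at hb
      | cons y b =>
        have h := ih a b (by simpa using ha) (by simpa using hb) hPa
          (fun z hz => hPb z (by simp [hz]))
        have hy := hPb y (by simp)
        simp [weave, hy, h.1, h.2.1, h.2.2]
    · cases a with
      | nil => simp at ha
      | cons y a =>
        have h := ih a b (by simpa using ha) (by simpa using hb)
          (fun z hz => hPa z (by simp [hz])) hPb
        have hy := hPa y (by simp)
        simp [weave, hy, h.1, h.2.1, h.2.2]

theorem mem_of_mem_weave {α : Type*} {m : List Bool} {a b : List α} {x : α}
    (h : x ∈ weave m a b) : x ∈ a ∨ x ∈ b := by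
  induction m generalizing a b with
  | nil => simp [weave] at h
  | cons y m ih =>
    cases y
    · cases b with
      | nil => simp [weave] at h
      | cons z b =>
        rcases List.mem_cons.1 h with rfl | h
        · simp
        · rcases ih h with h | h <;> simp [h]
    · cases a with
      | nil => simp [weave] at h
      | cons z a =>
        rcases List.mem_cons.1 h with rfl | h
        · simp
        · rcases ih h with h | h <;> simp [h]

theorem count_map_eq_length_filter {α : Type*} (P : α → Bool) (v : List α) :
    (v.map P).count true = (v.filter P).length ∧
      (v.map P).count false = (v.filter (fun x => !P x)).length := by
  induction v with
  | nil => simp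
  | cons x v ih => cases h : P x <;> simp [h, ih]

/-! ### Reversing a mask after its `p`-th `true` -/

/-- Reverse the part of a binary word following its `p`-th `true`. -/
def reverseAfter : ℕ → List Bool → List Bool
  | 0, m => m.reverse
  | _ + 1, [] => []
  | p + 1, true :: m => true :: reverseAfter p m
  | p + 1, false :: m => false :: reverseAfter (p + 1) m

theorem reverseAfter_reverseAfter (p : ℕ) (m : List Bool) :
    reverseAfter p (reverseAfter p m) = m := by
  induction m generalizing p with
  | nil => cases p <;> rfl
  | cons x m ih => cases p <;> cases x <;> simp [reverseAfter, ih]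

theorem count_reverseAfter (p : ℕ) (m : List Bool) (b : Bool) :
    (reverseAfter p m).count b = m.count b := by
  induction m generalizing p with
  | nil => cases p <;> rfl
  | cons x m ih =>
    cases p
    · exact (List.reverse_perm _).count_eq b
    · cases x <;> simp [reverseAfter, List.count_cons, ih]

/-- The word consisting of `a` copies of `y`, a single `x`, and `b` copies of `y`. -/
def singleIn {α : Type*} (y x : α) (a b : ℕ) : List α :=
  List.replicate a y ++ x :: List.replicate b y

theorem map_singleIn {α β : Type*} (g : α → β) (y x : α) (a b : ℕ) :
    (singleIn y x a b).map g = singleIn (g y) (g x) a b := by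
  simp [singleIn]

theorem singleIn_sublist_reverseAfter (p q : ℕ) (m : List Bool) :
    (singleIn true false (p + q) 0).Sublist (reverseAfter p m) ↔
      (singleIn true false p q).Sublist m := by
  induction m generalizing p with
  | nil => cases p <;> simp [singleIn, reverseAfter]
  | cons x m ih =>
    cases p with
    | zero =>
      rw [← List.reverse_sublist]
      simp [reverseAfter, singleIn]
    | succ p =>
      have e (a b : ℕ) : singleIn true false (a + 1) b = true :: singleIn true false a b := rfl
      rw [show p + 1 + q = p + q + 1 by ring, e, e]
      cases x
      · have h := ih (p + 1)
        rw [show p + 1 + q = p + q + 1 by ring, e, e] at h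
        simpa [reverseAfter, List.sublist_cons_iff] using h
      · simpa [reverseAfter] using ih p

/-! ### Rearranging the letter `r` among the smaller letters -/

/-- Rearrange the copies of `r` among the letters at most `r`, reversing the arrangement after the
`p`-th copy; larger letters keep their places and smaller letters keep their order. -/
def rearrange (p r : ℕ) (v : List ℕ) : List ℕ :=
  weave (v.map (fun x => decide (x ≤ r)))
    (weave (reverseAfter p ((v.filter (fun x => decide (x ≤ r))).map (fun x => decide (x = r))))
      ((v.filter (fun x => decide (x ≤ r))).filter (fun x => decide (x = r)))
      ((v.filter (fun x => decide (x ≤ r))).filter (fun x => !decide (x = r))))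
    (v.filter (fun x => !decide (x ≤ r)))

theorem rearrange_low_spec (p r : ℕ) (l : List ℕ) :
    let l' := weave (reverseAfter p (l.map (fun x => decide (x = r))))
      (l.filter (fun x => decide (x = r))) (l.filter (fun x => !decide (x = r)))
    l'.map (fun x => decide (x = r)) = reverseAfter p (l.map (fun x => decide (x = r))) ∧
      l'.filter (fun x => decide (x = r)) = l.filter (fun x => decide (x = r)) ∧
      l'.filter (fun x => !decide (x = r)) = l.filter (fun x => !decide (x = r)) := by
  have h := count_map_eq_length_filter (fun x => decide (x = r)) l
  apply weave_spec
  · rw [count_reverseAfter, h.1]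
  · rw [count_reverseAfter, h.2]
  · intro x hx
    exact (List.mem_filter.1 hx).2
  · intro x hx
    simpa using (List.mem_filter.1 hx).2

theorem rearrange_low_length (p r : ℕ) (l : List ℕ) :
    (weave (reverseAfter p (l.map (fun x => decide (x = r))))
      (l.filter (fun x => decide (x = r))) (l.filter (fun x => !decide (x = r)))).length
      = l.length := by
  have h := congrArg List.length (rearrange_low_spec p r l).1
  have h2 := List.length_eq_length_filter_add
    (l := reverseAfter p (l.map (fun x => decide (x = r)))) id
  have h3 := List.length_eq_length_filter_add (l := l) (fun x => decide (x = r))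
  have h4 := count_map_eq_length_filter (fun x => decide (x = r)) l
  have h5 := count_map_eq_length_filter id (reverseAfter p (l.map (fun x => decide (x = r))))
  simp only [List.map_id, count_reverseAfter] at h5
  simp only [List.length_map] at h
  omega

theorem rearrange_spec (p r : ℕ) (v : List ℕ) :
    (rearrange p r v).map (fun x => decide (x ≤ r)) = v.map (fun x => decide (x ≤ r)) ∧
      (rearrange p r v).filter (fun x => decide (x ≤ r)) =
        (let l := v.filter (fun x => decide (x ≤ r))
        weave (reverseAfter p (l.map (fun x => decide (x = r))))
          (l.filter (fun x => decide (x = r))) (l.filter (fun x => !decide (x = r)))) ∧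
      (rearrange p r v).filter (fun x => !decide (x ≤ r)) =
        v.filter (fun x => !decide (x ≤ r)) := by
  have h := count_map_eq_length_filter (fun x => decide (x ≤ r)) v
  apply weave_spec
  · rw [h.1, rearrange_low_length]
  · rw [h.2]
  · intro x hx
    rcases mem_of_mem_weave hx with hx | hx <;>
      exact (List.mem_filter.1 (List.mem_filter.1 hx).1).2
  · intro x hx
    simpa using (List.mem_filter.1 hx).2

theorem rearrange_rearrange (p r : ℕ) (v : List ℕ) : rearrange p r (rearrange p r v) = v := by
  obtain ⟨h1, h2, h3⟩ := rearrange_spec p r v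
  obtain ⟨k1, k2, k3⟩ := rearrange_low_spec p r (v.filter (fun x => decide (x ≤ r)))
  rw [rearrange, h1, h2, h3]
  dsimp only at k1 k2 k3 ⊢
  rw [k1, k2, k3, reverseAfter_reverseAfter, weave_map_filter, weave_map_filter]

theorem mem_of_mem_rearrange {p r x : ℕ} {v : List ℕ} (h : x ∈ rearrange p r v) : x ∈ v := by
  rcases mem_of_mem_weave h with h | h
  · rcases mem_of_mem_weave h with h | h <;>
      exact (List.mem_filter.1 (List.mem_filter.1 h).1).1
  · exact (List.mem_filter.1 h).1

theorem map_max_eq_replicate {r : ℕ} {l : List ℕ} (h : ∀ x ∈ l, x ≤ r) :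
    l.map (max r) = List.replicate l.length r := by
  rw [List.eq_replicate_iff]
  refine ⟨by simp, ?_⟩
  intro b hb
  obtain ⟨x, hx, rfl⟩ := List.mem_map.1 hb
  exact max_eq_left (h x hx)

theorem map_max_rearrange (p r : ℕ) (v : List ℕ) :
    (rearrange p r v).map (max r) = v.map (max r) := by
  conv_rhs => rw [← weave_map_filter (fun x => decide (x ≤ r)) v, map_weave,
    map_max_eq_replicate (l := v.filter (fun x => decide (x ≤ r)))
      (fun x hx => by simpa using (List.mem_filter.1 hx).2)]
  rw [rearrange, map_weave, map_max_eq_replicate, rearrange_low_length]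
  intro x hx
  rcases mem_of_mem_weave hx with hx | hx <;>
    simpa using (List.mem_filter.1 (List.mem_filter.1 hx).1).2

theorem filter_lt_rearrange (p r : ℕ) (v : List ℕ) :
    (rearrange p r v).filter (fun x => decide (x < r)) = v.filter (fun x => decide (x < r)) := by
  have e (u : List ℕ) : u.filter (fun x => decide (x < r)) =
      (u.filter (fun x => decide (x ≤ r))).filter (fun x => !decide (x = r)) := by
    rw [List.filter_filter]
    congr 1
    funext x
    rw [Bool.eq_iff_iff]
    simp
    omega
  rw [e, e, (rearrange_spec p r v).2.1]
  exact (rearrange_low_spec p r _).2.2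

theorem exists_singleIn_sublist_iff (r a b : ℕ) (v : List ℕ) :
    (∃ x < r, (singleIn r x a b).Sublist v) ↔
      (singleIn true false a b).Sublist
        ((v.filter (fun x => decide (x ≤ r))).map (fun x => decide (x = r))) := by
  constructor
  · rintro ⟨x, hx, h⟩
    have h' := (h.filter (fun x => decide (x ≤ r))).map (fun x => decide (x = r))
    have e : (singleIn r x a b).filter (fun x => decide (x ≤ r)) = singleIn r x a b := by
      rw [List.filter_eq_self]
      intro y hy
      simp only [singleIn, List.mem_append, List.mem_cons, List.mem_replicate] at hy
      rw [decide_eq_true_eq]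
      omega
    rw [e, map_singleIn] at h'
    simpa [hx.ne] using h'
  · intro h
    obtain ⟨l, hl, e⟩ := List.sublist_map_iff.1 h
    obtain ⟨l1, l2, rfl, e1, e2⟩ := List.map_eq_append_iff.1 e.symm
    obtain ⟨x, l3, rfl, e3, e4⟩ := List.map_eq_cons_iff.1 e2
    have key (n : ℕ) (l : List ℕ)
        (h : l.map (fun x => decide (x = r)) = List.replicate n true) :
        l = List.replicate n r := by
      obtain ⟨h1, h2⟩ := List.eq_replicate_iff.1 h
      refine List.eq_replicate_iff.2 ⟨by simpa using h1, fun y hy => ?_⟩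
      simpa using h2 _ (List.mem_map_of_mem (f := fun x => decide (x = r)) hy)
    rw [key _ _ e1, key _ _ e4] at hl
    refine ⟨x, ?_, hl.trans List.filter_sublist⟩
    have hx := (List.mem_filter.1 (hl.subset (show x ∈ _ by simp))).2
    simp only [decide_eq_true_eq, decide_eq_false_iff_not] at hx e3
    omega

theorem exists_singleIn_sublist_rearrange_iff (p q r : ℕ) (v : List ℕ) :
    (∃ x < r, (singleIn r x (p + q) 0).Sublist (rearrange p r v)) ↔
      ∃ x < r, (singleIn r x p q).Sublist v := by
  rw [exists_singleIn_sublist_iff, exists_singleIn_sublist_iff, (rearrange_spec p r v).2.1]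
  dsimp only
  rw [(rearrange_low_spec p r _).1, singleIn_sublist_reverseAfter]

/-! ### Canonical sequences -/

/-- A continuation of a canonical sequence with maximum `m`. -/
def CanonicalFrom : ℕ → List ℕ → Prop
  | _, [] => True
  | m, a :: l => (1 ≤ a ∧ a ≤ m + 1) ∧ CanonicalFrom (max a m) l

theorem foldr_max_max (a m : ℕ) (l : List ℕ) :
    l.foldr max (max a m) = max a (l.foldr max m) := by
  induction l with
  | nil => rfl
  | cons x l ih => simp only [List.foldr_cons, ih]; omega

theorem canonicalFrom_iff (m : ℕ) (l : List ℕ) :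
    CanonicalFrom m l ↔ ∀ i (h : i < l.length),
      1 ≤ l.get ⟨i, h⟩ ∧ l.get ⟨i, h⟩ ≤ (l.take i).foldr max m + 1 := by
  induction l generalizing m with
  | nil => simp [CanonicalFrom]
  | cons a l ih =>
    rw [CanonicalFrom, ih]
    constructor
    · rintro ⟨h1, h2⟩ i hi
      cases i with
      | zero => simpa using h1
      | succ i =>
        have h := h2 i (by simpa using hi)
        rw [foldr_max_max] at h
        simpa using h
    · intro h
      refine ⟨by simpa using h 0 (by simp), fun i hi => ?_⟩
      have h' := h (i + 1) (by simpa using hi)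
      rw [foldr_max_max]
      simpa using h'

theorem isCanonicalSeq_iff (l : List ℕ) : IsCanonicalSeq l ↔ CanonicalFrom 0 l :=
  (canonicalFrom_iff 0 l).symm

theorem canonicalFrom_append (m : ℕ) (u v : List ℕ) :
    CanonicalFrom m (u ++ v) ↔ CanonicalFrom m u ∧ CanonicalFrom (u.foldr max m) v := by
  induction u generalizing m with
  | nil => simp [CanonicalFrom]
  | cons a u ih => simp [CanonicalFrom, ih, foldr_max_max, and_assoc]

theorem CanonicalFrom.one_le {m x : ℕ} {l : List ℕ} (h : CanonicalFrom m l) (hx : x ∈ l) :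
    1 ≤ x := by
  induction l generalizing m with
  | nil => simp at hx
  | cons a l ih =>
    rcases List.mem_cons.1 hx with rfl | hx
    · exact h.1.1
    · exact ih h.2 hx

theorem CanonicalFrom.le_add_length {m x : ℕ} {l : List ℕ} (h : CanonicalFrom m l)
    (hx : x ∈ l) : x ≤ m + l.length := by
  induction l generalizing m with
  | nil => simp at hx
  | cons a l ih =>
    have h1 := h.1
    rw [List.length_cons]
    rcases List.mem_cons.1 hx with rfl | hx
    · omega
    · have h2 := ih h.2 hx
      omega

theorem CanonicalFrom.mem_of_le {m x y : ℕ} {l : List ℕ} (h : CanonicalFrom m l) (hx : x ∈ l)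
    (hm : m < y) (hyx : y ≤ x) : y ∈ l := by
  induction l generalizing m with
  | nil => simp at hx
  | cons a l ih =>
    have h1 := h.1
    rw [List.mem_cons]
    by_cases hya : y = a
    · exact Or.inl hya
    · rcases List.mem_cons.1 hx with rfl | hx
      · omega
      · exact Or.inr (ih h.2 hx (by omega))

theorem CanonicalFrom.cons_sublist {m r : ℕ} {s l : List ℕ} (h : CanonicalFrom m l)
    (hr : r ∈ l) (hm : m < r) (hs : s.Sublist l) (hlt : ∀ x ∈ s, r < x) :
    (r :: s).Sublist l := by
  induction l generalizing m with
  | nil => simp at hr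
  | cons a l ih =>
    have h1 := h.1
    have hsl : s.Sublist l := by
      rcases List.sublist_cons_iff.1 hs with hs | ⟨s', rfl, -⟩
      · exact hs
      · have := hlt a (by simp)
        omega
    by_cases hra : r = a
    · subst hra
      exact hsl.cons_cons r
    · have hr' : r ∈ l := by simpa [hra] using hr
      exact (ih h.2 hr' (by omega) hsl).cons a

theorem CanonicalFrom.append_sublist {m : ℕ} {t s l : List ℕ} (h : CanonicalFrom m l)
    (ht : t.Pairwise (· < ·)) (htl : ∀ x ∈ t, x ∈ l ∧ m < x) (hs : s.Sublist l)
    (hts : ∀ x ∈ t, ∀ y ∈ s, x < y) : (t ++ s).Sublist l := by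
  induction t with
  | nil => exact hs
  | cons a t ih =>
    have hp := List.pairwise_cons.1 ht
    refine h.cons_sublist (htl a (by simp)).1 (htl a (by simp)).2
      (ih hp.2 (fun x hx => htl x (by simp [hx])) fun x hx => hts x (by simp [hx])) ?_
    intro x hx
    rcases List.mem_append.1 hx with hx | hx
    · exact hp.1 x hx
    · exact hts a (by simp) x hx

theorem CanonicalFrom.congr_map_max {m r : ℕ} {v v' : List ℕ} (h : CanonicalFrom m v)
    (hr : r ≤ m) (hv : v'.map (max r) = v.map (max r)) (h1 : ∀ x ∈ v', 1 ≤ x) :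
    CanonicalFrom m v' ∧ v'.foldr max m = v.foldr max m := by
  induction v generalizing v' m with
  | nil =>
    have : v' = [] := by simpa using hv
    simp [this, CanonicalFrom]
  | cons a v ih =>
    cases v' with
    | nil => simp at hv
    | cons b v' =>
      simp only [List.map_cons, List.cons.injEq] at hv
      have h0 := h.1
      have hb := h1 b (by simp)
      have e : max b m = max a m := by omega
      have ih' := ih h.2 (by omega) hv.2 (fun x hx => h1 x (by simp [hx]))
      refine ⟨⟨⟨hb, by omega⟩, e ▸ ih'.1⟩, ?_⟩
      have := ih'.2
      rw [foldr_max_max, foldr_max_max] at this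
      simp only [List.foldr_cons]
      have e2 (l : List ℕ) : m ≤ l.foldr max m := by
        induction l with
        | nil => simp
        | cons x l ih => simp only [List.foldr_cons]; omega
      have := e2 v
      have := e2 v'
      omega

theorem le_foldr_max {m x : ℕ} {l : List ℕ} (hx : x ∈ l) : x ≤ l.foldr max m := by
  induction l with
  | nil => simp at hx
  | cons a l ih =>
    simp only [List.foldr_cons]
    rcases List.mem_cons.1 hx with rfl | hx
    · omega
    · have := ih hx
      omega

theorem canonicalFrom_rearrange {p r : ℕ} {u v w : List ℕ} (h : CanonicalFrom 0 (u ++ v ++ w))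
    (hr : r ∈ u) : CanonicalFrom 0 (u ++ rearrange p r v ++ w) := by
  rw [canonicalFrom_append, canonicalFrom_append] at h ⊢
  obtain ⟨⟨hu, hv⟩, hw⟩ := h
  obtain ⟨h1, h2⟩ := hv.congr_map_max (le_foldr_max hr) (map_max_rearrange p r v)
    (fun x hx => hv.one_le (mem_of_mem_rearrange hx))
  rw [List.foldr_append] at hw ⊢
  refine ⟨⟨hu, h1⟩, ?_⟩
  have e (l : List ℕ) : (l.foldr max 0) ≤ l.foldr max (u.foldr max 0) := by
    have := foldr_max_max (u.foldr max 0) 0 l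
    simp only [max_zero] at this
    omega
  have c (l : List ℕ) : u.foldr max (l.foldr max 0) = l.foldr max (u.foldr max 0) := by
    have h1 := foldr_max_max (u.foldr max 0) 0 l
    have h2 := foldr_max_max (l.foldr max 0) 0 u
    simp only [max_zero] at h1 h2
    omega
  rw [c, h2, ← c]
  exact hw

/-! ### Occurrences at a level -/

/-- `π` factors as `u ++ v ++ w` where `u` satisfies `L r`, `w` satisfies `R r`, and `v` contains
a subsequence of `a` copies of `r`, one smaller letter, and `b` copies of `r`. -/
def OccursAt (L R : ℕ → List ℕ → Prop) (a b r : ℕ) (π : List ℕ) : Prop :=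
  ∃ u v w, π = u ++ v ++ w ∧ L r u ∧ R r w ∧ ∃ x < r, (singleIn r x a b).Sublist v

/-- Conditions on prefixes and suffixes, nested in the level `r` and insensitive to the
letters below `r`. -/
structure IsFrame (L R : ℕ → List ℕ → Prop) : Prop where
  mem_left : ∀ {r u}, CanonicalFrom 0 u → 1 ≤ r → L r u → r ∈ u
  mono_left : ∀ {r s u}, CanonicalFrom 0 u → 1 ≤ r → r ≤ s → L s u → L r u
  congr_left : ∀ {r s u u'}, r < s → u'.map (max r) = u.map (max r) → L s u → L s u'
  mono_right : ∀ {r s w}, r ≤ s → R s w → R r w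
  congr_right : ∀ {r s w z}, r < s → z.map (max r) = w.map (max r) → R s w → R s z

/-- `π = u ++ v ++ w` with `u` and `w` shortest subject to `L r u` and `R r w`. -/
structure IsSplit (L R : ℕ → List ℕ → Prop) (r : ℕ) (π u v w : List ℕ) : Prop where
  eq : π = u ++ v ++ w
  left : L r u
  right : R r w
  min_left : ∀ u', u' <+: u → L r u' → u' = u
  min_right : ∀ w', w' <:+ w → R r w' → w' = w

theorem exists_prefix_minimal {P : List ℕ → Prop} {u : List ℕ} (h : P u) :
    ∃ u₀, u₀ <+: u ∧ P u₀ ∧ ∀ u', u' <+: u₀ → P u' → u' = u₀ := by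
  induction hn : u.length using Nat.strong_induction_on generalizing u with
  | _ n ih =>
    by_cases hmin : ∀ u', u' <+: u → P u' → u' = u
    · exact ⟨u, List.prefix_rfl, h, hmin⟩
    · push Not at hmin
      obtain ⟨u', h1, h2, h3⟩ := hmin
      have hlt : u'.length < n := by
        rw [← hn]
        exact lt_of_le_of_ne h1.length_le fun e => h3 (h1.eq_of_length e)
      obtain ⟨u₀, k1, k2, k3⟩ := ih _ hlt h2 rfl
      exact ⟨u₀, k1.trans h1, k2, k3⟩

theorem exists_suffix_minimal {P : List ℕ → Prop} {u : List ℕ} (h : P u) :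
    ∃ u₀, u₀ <:+ u ∧ P u₀ ∧ ∀ u', u' <:+ u₀ → P u' → u' = u₀ := by
  obtain ⟨u₀, h1, h2, h3⟩ := exists_prefix_minimal (P := fun l => P l.reverse) (u := u.reverse)
    (by simpa using h)
  refine ⟨u₀.reverse, ?_, h2, fun u' h4 h5 => ?_⟩
  · simpa using List.reverse_suffix.2 h1
  · rw [← h3 u'.reverse ?_ (by simpa using h5)]
    · simp
    · rw [← List.reverse_suffix]
      simpa using h4

theorem exists_isSplit {L R : ℕ → List ℕ → Prop} {r : ℕ} {π u v w : List ℕ}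
    (e : π = u ++ v ++ w) (hu : L r u) (hw : R r w) :
    ∃ u₀ a b w₀, u = u₀ ++ a ∧ w = b ++ w₀ ∧ IsSplit L R r π u₀ (a ++ v ++ b) w₀ := by
  obtain ⟨u₀, ⟨a, rfl⟩, h2, h3⟩ := exists_prefix_minimal hu
  obtain ⟨w₀, ⟨b, rfl⟩, k2, k3⟩ := exists_suffix_minimal hw
  exact ⟨u₀, a, b, w₀, rfl, rfl, by simp [e], h2, k2, h3, k3⟩

theorem IsSplit.unique {L R : ℕ → List ℕ → Prop} {r : ℕ} {π u v w u' v' w' : List ℕ}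
    (h : IsSplit L R r π u v w) (h' : IsSplit L R r π u' v' w') : u = u' ∧ v = v' ∧ w = w' := by
  have hu : u <+: π := ⟨v ++ w, by simp [h.eq]⟩
  have hu' : u' <+: π := ⟨v' ++ w', by simp [h'.eq]⟩
  have hw : w <:+ π := ⟨u ++ v, by simp [h.eq]⟩
  have hw' : w' <:+ π := ⟨u' ++ v', by simp [h'.eq]⟩
  have eu : u = u' := by
    rcases le_total u.length u'.length with k | k
    · exact h'.min_left _ (List.prefix_of_prefix_length_le hu hu' k) h.left
    · exact (h.min_left _ (List.prefix_of_prefix_length_le hu' hu k) h'.left).symm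
  have ew : w = w' := by
    rcases List.suffix_or_suffix_of_suffix hw hw' with k | k
    · exact h'.min_right _ k h.right
    · exact (h.min_right _ k h'.right).symm
  subst eu ew
  refine ⟨rfl, ?_, rfl⟩
  simpa using h.eq.symm.trans h'.eq

open Classical in
/-- Rearrange the middle part of the shortest factorization of `π` at level `r`. -/
noncomputable def rearrangeAt (L R : ℕ → List ℕ → Prop) (p r : ℕ) (π : List ℕ) : List ℕ :=
  if h : ∃ d : List ℕ × List ℕ × List ℕ, IsSplit L R r π d.1 d.2.1 d.2.2 then
    h.choose.1 ++ rearrange p r h.choose.2.1 ++ h.choose.2.2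
  else π

theorem IsSplit.rearrangeAt_eq {L R : ℕ → List ℕ → Prop} {r : ℕ} {π u v w : List ℕ}
    (h : IsSplit L R r π u v w) (p : ℕ) :
    rearrangeAt L R p r π = u ++ rearrange p r v ++ w := by
  have hex : ∃ d : List ℕ × List ℕ × List ℕ, IsSplit L R r π d.1 d.2.1 d.2.2 := ⟨(u, v, w), h⟩
  obtain ⟨e1, e2, e3⟩ := hex.choose_spec.unique h
  rw [rearrangeAt, dif_pos hex, e1, e2, e3]

theorem IsSplit.rearrangeAt {L R : ℕ → List ℕ → Prop} {r : ℕ} {π u v w : List ℕ}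
    (h : IsSplit L R r π u v w) (p : ℕ) :
    IsSplit L R r (rearrangeAt L R p r π) u (rearrange p r v) w :=
  ⟨h.rearrangeAt_eq p, h.left, h.right, h.min_left, h.min_right⟩

theorem rearrangeAt_of_not {L R : ℕ → List ℕ → Prop} {r : ℕ} {π : List ℕ}
    (h : ¬ ∃ u v w, IsSplit L R r π u v w) (p : ℕ) : rearrangeAt L R p r π = π := by
  rw [rearrangeAt, dif_neg]
  rintro ⟨d, hd⟩
  exact h ⟨_, _, _, hd⟩

theorem rearrangeAt_rearrangeAt (L R : ℕ → List ℕ → Prop) (p r : ℕ) (π : List ℕ) :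
    rearrangeAt L R p r (rearrangeAt L R p r π) = π := by
  by_cases h : ∃ u v w, IsSplit L R r π u v w
  · obtain ⟨u, v, w, h⟩ := h
    rw [(h.rearrangeAt p).rearrangeAt_eq, rearrange_rearrange, h.eq]
  · rw [rearrangeAt_of_not h, rearrangeAt_of_not h]

theorem length_rearrangeAt (L R : ℕ → List ℕ → Prop) (p r : ℕ) (π : List ℕ) :
    (rearrangeAt L R p r π).length = π.length := by
  by_cases h : ∃ u v w, IsSplit L R r π u v w
  · obtain ⟨u, v, w, h⟩ := h
    have e := congrArg List.length (map_max_rearrange p r v)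
    simp only [List.length_map] at e
    rw [h.rearrangeAt_eq, h.eq]
    simp [e]
  · rw [rearrangeAt_of_not h]

theorem canonicalFrom_rearrangeAt {L R : ℕ → List ℕ → Prop} (hLR : IsFrame L R) {p r : ℕ}
    (hr : 1 ≤ r) {π : List ℕ} (hπ : CanonicalFrom 0 π) :
    CanonicalFrom 0 (rearrangeAt L R p r π) := by
  by_cases h : ∃ u v w, IsSplit L R r π u v w
  · obtain ⟨u, v, w, h⟩ := h
    rw [h.rearrangeAt_eq]
    rw [h.eq] at hπ
    have hu := ((canonicalFrom_append _ _ _).1 ((canonicalFrom_append _ _ _).1 hπ).1).1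
    exact canonicalFrom_rearrange hπ (hLR.mem_left hu hr h.left)
  · rwa [rearrangeAt_of_not h]

theorem IsSplit.occursAt_iff {L R : ℕ → List ℕ → Prop} {r : ℕ} {π u v w : List ℕ}
    (h : IsSplit L R r π u v w) (a b : ℕ) :
    OccursAt L R a b r π ↔ ∃ x < r, (singleIn r x a b).Sublist v := by
  constructor
  · rintro ⟨u', v', w', e, hu, hw, x, hx, hs⟩
    obtain ⟨u₀, c, d, w₀, -, -, h'⟩ := exists_isSplit e hu hw
    obtain ⟨-, rfl, -⟩ := h.unique h'
    exact ⟨x, hx, hs.trans (((List.infix_append c v' d)).sublist)⟩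
  · exact fun hx => ⟨u, v, w, h.eq, h.left, h.right, hx⟩

theorem occursAt_rearrangeAt_iff (L R : ℕ → List ℕ → Prop) (p q r : ℕ) (π : List ℕ) :
    OccursAt L R (p + q) 0 r (rearrangeAt L R p r π) ↔ OccursAt L R p q r π := by
  by_cases h : ∃ u v w, IsSplit L R r π u v w
  · obtain ⟨u, v, w, h⟩ := h
    rw [h.occursAt_iff, (h.rearrangeAt p).occursAt_iff, exists_singleIn_sublist_rearrange_iff]
  · have key (a b : ℕ) : ¬ OccursAt L R a b r π := by
      rintro ⟨u, v, w, e, hu, hw, -⟩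
      obtain ⟨u₀, c, d, w₀, -, -, h'⟩ := exists_isSplit e hu hw
      exact h ⟨_, _, _, h'⟩
    rw [rearrangeAt_of_not h]
    simp [key]

theorem occursAt_of_map_max_eq {L R : ℕ → List ℕ → Prop} (hLR : IsFrame L R) {a b r s : ℕ}
    (hrs : r < s) {π π' : List ℕ} (hπ : π'.map (max r) = π.map (max r))
    (h : OccursAt L R a b s π) : OccursAt L R a b s π' := by
  obtain ⟨u, v, w, rfl, hu, hw, x, hx, hv⟩ := h
  simp only [List.map_append] at hπ
  obtain ⟨l, w', rfl, e, ew⟩ := List.map_eq_append_iff.1 hπ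
  obtain ⟨u', v', rfl, eu, ev⟩ := List.map_eq_append_iff.1 e
  refine ⟨u', v', w', rfl, hLR.congr_left hrs eu hu, hLR.congr_right hrs ew hw, ?_⟩
  have h1 := hv.map (max r)
  rw [map_singleIn, ← ev] at h1
  obtain ⟨l, hl, e⟩ := List.sublist_map_iff.1 h1
  obtain ⟨l1, l2, rfl, e1, e2⟩ := List.map_eq_append_iff.1 e.symm
  obtain ⟨y, l3, rfl, e3, e4⟩ := List.map_eq_cons_iff.1 e2
  have key (n : ℕ) (l : List ℕ) (h : l.map (max r) = List.replicate n (max r s)) :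
      l = List.replicate n s := by
    obtain ⟨h1, h2⟩ := List.eq_replicate_iff.1 h
    refine List.eq_replicate_iff.2 ⟨by simpa using h1, fun y hy => ?_⟩
    have := h2 _ (List.mem_map_of_mem (f := max r) hy)
    omega
  rw [key _ _ e1, key _ _ e4] at hl
  exact ⟨y, by omega, hl⟩

theorem occursAt_rearrangeAt_of_gt {L R : ℕ → List ℕ → Prop} (hLR : IsFrame L R)
    {a b p r s : ℕ} (hrs : r < s) {π : List ℕ} (h : OccursAt L R a b s π) :
    OccursAt L R a b s (rearrangeAt L R p r π) := by
  by_cases hd : ∃ u v w, IsSplit L R r π u v w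
  · obtain ⟨u, v, w, hd⟩ := hd
    refine occursAt_of_map_max_eq hLR hrs ?_ h
    rw [hd.rearrangeAt_eq, hd.eq]
    simp [map_max_rearrange]
  · rwa [rearrangeAt_of_not hd]

theorem occursAt_rearrangeAt_of_lt {L R : ℕ → List ℕ → Prop} (hLR : IsFrame L R)
    {a b p r s : ℕ} (hs : 1 ≤ s) (hsr : s < r) {π : List ℕ} (hπ : CanonicalFrom 0 π)
    (h : OccursAt L R a b s π) : OccursAt L R a b s (rearrangeAt L R p r π) := by
  by_cases hd : ∃ u v w, IsSplit L R r π u v w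
  · obtain ⟨u₀, v₀, w₀, hd⟩ := hd
    obtain ⟨u, v, w, e, hu, hw, x, hx, hv⟩ := h
    obtain ⟨u₁, c, d, w₁, -, -, h1⟩ := exists_isSplit e hu hw
    rw [hd.rearrangeAt_eq]
    have hu₀ : CanonicalFrom 0 u₀ := by
      rw [hd.eq, List.append_assoc] at hπ
      exact ((canonicalFrom_append _ _ _).1 hπ).1
    obtain ⟨u₂, c', d', w₂, rfl, rfl, h2⟩ := exists_isSplit hd.eq
      (hLR.mono_left hu₀ hs hsr.le hd.left) (hLR.mono_right hsr.le hd.right)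
    obtain ⟨-, ev, -⟩ := h1.unique h2
    refine ⟨u₂, c' ++ rearrange p r v₀ ++ d', w₂, by simp, h2.left, h2.right, x, hx, ?_⟩
    have h3 := (hv.trans (List.infix_append c v d).sublist).filter (fun x => decide (x < r))
    have e1 : (singleIn s x a b).filter (fun x => decide (x < r)) = singleIn s x a b := by
      rw [List.filter_eq_self]
      intro y hy
      simp only [singleIn, List.mem_append, List.mem_cons, List.mem_replicate] at hy
      rw [decide_eq_true_eq]
      omega
    rw [e1, ev, List.filter_append, List.filter_append, ← filter_lt_rearrange p r v₀,
      ← List.filter_append, ← List.filter_append] at h3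
    exact h3.trans List.filter_sublist
  · rwa [rearrangeAt_of_not hd]

theorem occursAt_rearrangeAt_iff_of_ne {L R : ℕ → List ℕ → Prop} (hLR : IsFrame L R)
    {a b p r s : ℕ} (hr : 1 ≤ r) (hs : 1 ≤ s) (hrs : r ≠ s) {π : List ℕ}
    (hπ : CanonicalFrom 0 π) :
    OccursAt L R a b s (rearrangeAt L R p r π) ↔ OccursAt L R a b s π := by
  rcases Nat.lt_or_gt_of_ne hrs with h | h
  · refine ⟨fun k => ?_, occursAt_rearrangeAt_of_gt hLR h⟩
    have := occursAt_rearrangeAt_of_gt hLR (p := p) h k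
    rwa [rearrangeAt_rearrangeAt] at this
  · refine ⟨fun k => ?_, occursAt_rearrangeAt_of_lt hLR hs h hπ⟩
    have := occursAt_rearrangeAt_of_lt hLR (p := p) hs h (canonicalFrom_rearrangeAt hLR hr hπ) k
    rwa [rearrangeAt_rearrangeAt] at this

/-- Canonical sequences of length `n` avoiding `2^(p+q)1` at levels `1, …, t` and
`2^p12^q` at levels above `t`. -/
def hybridAvoiders (L R : ℕ → List ℕ → Prop) (p q n t : ℕ) : Set (List ℕ) :=
  {π | π.length = n ∧ CanonicalFrom 0 π ∧ ∀ r, 1 ≤ r →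
    (r ≤ t → ¬ OccursAt L R (p + q) 0 r π) ∧ (t < r → ¬ OccursAt L R p q r π)}

theorem rearrangeAt_mem_hybridAvoiders_iff {L R : ℕ → List ℕ → Prop} (hLR : IsFrame L R)
    (p q n t : ℕ) (π : List ℕ) :
    rearrangeAt L R p (t + 1) π ∈ hybridAvoiders L R p q n (t + 1) ↔
      π ∈ hybridAvoiders L R p q n t := by
  have hcan : CanonicalFrom 0 (rearrangeAt L R p (t + 1) π) ↔ CanonicalFrom 0 π := by
    refine ⟨fun h => ?_, canonicalFrom_rearrangeAt hLR (by omega)⟩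
    have := canonicalFrom_rearrangeAt hLR (p := p) (r := t + 1) (by omega) h
    rwa [rearrangeAt_rearrangeAt] at this
  simp only [hybridAvoiders, Set.mem_ofPred_eq, length_rearrangeAt, hcan]
  refine and_congr_right fun _ => and_congr_right fun hπ => forall_congr' fun r => ?_
  refine imp_congr_right fun hr => ?_
  by_cases e : t + 1 = r
  · subst e
    rw [occursAt_rearrangeAt_iff]
    simp
  · rw [occursAt_rearrangeAt_iff_of_ne hLR (by omega) hr e hπ,
      occursAt_rearrangeAt_iff_of_ne hLR (by omega) hr e hπ,
      show r ≤ t + 1 ↔ r ≤ t by omega, show t + 1 < r ↔ t < r by omega]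

theorem ncard_hybridAvoiders {L R : ℕ → List ℕ → Prop} (hLR : IsFrame L R) (p q n t : ℕ) :
    (hybridAvoiders L R p q n t).ncard = (hybridAvoiders L R p q n 0).ncard := by
  induction t with
  | zero => rfl
  | succ t ih =>
    have hinv : Function.Involutive (rearrangeAt L R p (t + 1)) :=
      rearrangeAt_rearrangeAt L R p (t + 1)
    rw [← ih, ← Set.ncard_image_of_injective (hybridAvoiders L R p q n t) hinv.injective]
    congr 1
    ext π
    rw [hinv.image_eq_preimage_symm, Set.mem_preimage,
      ← rearrangeAt_mem_hybridAvoiders_iff hLR p q n t, rearrangeAt_rearrangeAt]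

theorem OccursAt.le_length {L R : ℕ → List ℕ → Prop} (hLR : IsFrame L R) {a b r : ℕ}
    {π : List ℕ} (hr : 1 ≤ r) (hπ : CanonicalFrom 0 π) (h : OccursAt L R a b r π) :
    r ≤ π.length := by
  obtain ⟨u, v, w, rfl, hu, -⟩ := h
  have hc : CanonicalFrom 0 u := by
    rw [List.append_assoc] at hπ
    exact ((canonicalFrom_append _ _ _).1 hπ).1
  have := hπ.le_add_length (x := r) (by simp [hLR.mem_left hc hr hu])
  omega

theorem patEquiv_of_occursAt_iff {L R : ℕ → List ℕ → Prop} (hLR : IsFrame L R) {p q : ℕ}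
    {σ σ' : List ℕ}
    (h : ∀ π, CanonicalFrom 0 π → (ContainsPat π σ ↔ ∃ r, 1 ≤ r ∧ OccursAt L R p q r π))
    (h' : ∀ π, CanonicalFrom 0 π →
      (ContainsPat π σ' ↔ ∃ r, 1 ≤ r ∧ OccursAt L R (p + q) 0 r π)) :
    PatEquiv σ σ' := by
  intro n
  have e : {π : List ℕ | π.length = n ∧ IsCanonicalSeq π ∧ AvoidsPat π σ} =
      hybridAvoiders L R p q n 0 := by
    ext π
    simp only [hybridAvoiders, Set.mem_ofPred_eq, isCanonicalSeq_iff]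
    refine and_congr_right fun _ => and_congr_right fun hπ => ?_
    rw [AvoidsPat, h π hπ]
    push Not
    refine forall_congr' fun r => imp_congr_right fun hr => ?_
    exact ⟨fun k => ⟨fun _ => by omega, fun _ => k⟩, fun k => k.2 (by omega)⟩
  have e' : {π : List ℕ | π.length = n ∧ IsCanonicalSeq π ∧ AvoidsPat π σ'} =
      hybridAvoiders L R p q n n := by
    ext π
    simp only [hybridAvoiders, Set.mem_ofPred_eq, isCanonicalSeq_iff]
    refine and_congr_right fun hn => and_congr_right fun hπ => ?_
    rw [AvoidsPat, h' π hπ]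
    push Not
    refine forall_congr' fun r => imp_congr_right fun hr => ?_
    refine ⟨fun k => ⟨fun _ => k, fun hlt ho => ?_⟩, fun k ho => k.1 ?_ ho⟩
    · have := ho.le_length hLR hr hπ
      omega
    · have := ho.le_length hLR hr hπ
      omega
  rw [pAvoid, pAvoid, e, e', ncard_hybridAvoiders hLR p q n n]

/-! ### Pattern containment through relabelling -/

theorem containsPat_iff (π σ : List ℕ) :
    ContainsPat π σ ↔ ∃ g : ℕ → ℕ, StrictMonoOn g {a | a ∈ σ} ∧ (σ.map g).Sublist π := by
  constructor
  · rintro ⟨f, hf, hσ⟩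
    have hg (i j : Fin σ.length) (h : σ.get i = σ.get j) : π.get (f i) = π.get (f j) := by
      have h1 := hσ i j
      have h2 := hσ j i
      omega
    classical
    let g : ℕ → ℕ := fun a => if h : ∃ i, σ.get i = a then π.get (f h.choose) else 0
    have hgi (i : Fin σ.length) : g (σ.get i) = π.get (f i) := by
      have hex : ∃ j, σ.get j = σ.get i := ⟨i, rfl⟩
      simp only [g]
      rw [dif_pos hex]
      exact hg _ _ hex.choose_spec
    refine ⟨g, ?_, ?_⟩
    · intro a ha b hb hab
      obtain ⟨i, rfl⟩ := List.get_of_mem ha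
      obtain ⟨j, rfl⟩ := List.get_of_mem hb
      rw [hgi, hgi]
      exact (hσ i j).1 hab
    · rw [List.sublist_iff_exists_fin_orderEmbedding_get_eq]
      have hl : (σ.map g).length = σ.length := List.length_map g
      refine ⟨OrderEmbedding.ofStrictMono (fun i => f (Fin.cast hl i)) ?_, ?_⟩
      · intro i j hij
        exact hf (by simpa using hij)
      · intro i
        rw [List.get_eq_getElem, List.getElem_map]
        exact hgi (Fin.cast hl i)
  · rintro ⟨g, hg, hs⟩
    obtain ⟨f, hf⟩ := List.sublist_iff_exists_fin_orderEmbedding_get_eq.1 hs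
    have hl : (σ.map g).length = σ.length := List.length_map g
    refine ⟨fun i => f (Fin.cast hl.symm i), ?_, ?_⟩
    · intro i j hij
      exact f.strictMono (by simpa using hij)
    · intro i j
      rw [← hf, ← hf]
      have := (hg.lt_iff_lt (List.get_mem σ i) (List.get_mem σ j)).symm
      simpa using this

theorem sublist_of_map_max_eq {r : ℕ} {s u u' : List ℕ} (hs : s.Sublist u) (hr : ∀ x ∈ s, r < x)
    (hu : u'.map (max r) = u.map (max r)) : s.Sublist u' := by
  have h := hs.map (max r)
  rw [← hu] at h
  obtain ⟨l, hl, e⟩ := List.sublist_map_iff.1 h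
  have es : s.map (max r) = s :=
    List.map_congr_left (fun x hx => max_eq_right (hr x hx).le) |>.trans (List.map_id s)
  have el : l.map (max r) = l := by
    refine List.map_congr_left (g := id) (fun x hx => ?_) |>.trans (List.map_id l)
    have h1 : max r x ∈ s := by
      rw [← es, e]
      exact List.mem_map_of_mem hx
    have := hr _ h1
    simp only [id]
    omega
  rw [← es, e, el]
  exact hl

theorem mem_of_map_max_eq {r x : ℕ} {u u' : List ℕ} (hx : x ∈ u) (hr : r < x)
    (hu : u'.map (max r) = u.map (max r)) : x ∈ u' := by
  rw [← List.singleton_sublist] at hx ⊢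
  exact sublist_of_map_max_eq hx (by simpa using hr) hu

/-- `l` contains a copy of `ρ` all of whose letters exceed `r`. -/
def HasCopyAbove (ρ : List ℕ) (r : ℕ) (l : List ℕ) : Prop :=
  ∃ g : ℕ → ℕ, StrictMonoOn g {a | a ∈ ρ} ∧ (∀ a ∈ ρ, r < g a) ∧ (ρ.map g).Sublist l

theorem HasCopyAbove.mono {ρ l : List ℕ} {r s : ℕ} (h : HasCopyAbove ρ s l) (hrs : r ≤ s) :
    HasCopyAbove ρ r l := by
  obtain ⟨g, h1, h2, h3⟩ := h
  exact ⟨g, h1, fun a ha => hrs.trans_lt (h2 a ha), h3⟩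

theorem HasCopyAbove.congr {ρ l l' : List ℕ} {r s : ℕ} (h : HasCopyAbove ρ s l) (hrs : r ≤ s)
    (hl : l'.map (max r) = l.map (max r)) : HasCopyAbove ρ s l' := by
  obtain ⟨g, h1, h2, h3⟩ := h
  refine ⟨g, h1, h2, sublist_of_map_max_eq h3 (fun x hx => ?_) hl⟩
  obtain ⟨a, ha, rfl⟩ := List.mem_map.1 hx
  exact hrs.trans_lt (h2 a ha)

theorem isFrame_copy_left (ρ : List ℕ) :
    IsFrame (fun r u => r ∈ u ∧ HasCopyAbove ρ r u) (fun _ _ => True) where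
  mem_left _ _ h := h.1
  mono_left hu hr hrs h := ⟨hu.mem_of_le h.1 hr hrs, h.2.mono hrs⟩
  congr_left hrs hu h := ⟨mem_of_map_max_eq h.1 hrs hu, h.2.congr hrs.le hu⟩
  mono_right _ _ := trivial
  congr_right _ _ _ := trivial

theorem isFrame_copy_right (ρ : List ℕ) (j : ℕ) :
    IsFrame (fun r u => r + j ∈ u) (fun r w => HasCopyAbove ρ (r + j) w) where
  mem_left hu hr h := hu.mem_of_le h hr (by omega)
  mono_left hu hr hrs h := hu.mem_of_le h (by omega) (by omega)
  congr_left hrs hu h := mem_of_map_max_eq h (by omega) hu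
  mono_right hrs h := h.mono (by omega)
  congr_right hrs hu h := h.congr (by omega) hu

theorem mem_singleIn {y x z a b : ℕ} (h : z ∈ singleIn y x a b) : z = y ∨ z = x := by
  simp only [singleIn, List.mem_append, List.mem_cons, List.mem_replicate] at h
  tauto

theorem containsPat_copy_left_iff {ρ : List ℕ} (hρ : ∀ a ∈ ρ, 2 < a) (a b : ℕ) {π : List ℕ}
    (hπ : CanonicalFrom 0 π) :
    ContainsPat π (1 :: 2 :: ρ ++ singleIn 2 1 a b) ↔
      ∃ r, 1 ≤ r ∧
        OccursAt (fun r u => r ∈ u ∧ HasCopyAbove ρ r u) (fun _ _ => True) a b r π := by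
  rw [containsPat_iff]
  constructor
  · rintro ⟨g, hg, hs⟩
    have h12 : g 1 < g 2 := hg (by simp) (by simp) (by norm_num)
    rw [List.map_append, map_singleIn] at hs
    obtain ⟨u, v, rfl, hu, hv⟩ := List.append_sublist_iff.1 hs
    refine ⟨g 2, by omega, u, v, [], by simp, ⟨?_, g, ?_, ?_, ?_⟩, trivial, g 1, h12, hv⟩
    · exact hu.subset (by simp)
    · exact hg.mono fun x hx => by
        have hx' : x ∈ ρ := hx
        simp [hx']
    · exact fun x hx => hg (by simp) (by simp [hx]) (hρ x hx)
    · rw [List.map_cons, List.map_cons] at hu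
      exact ((List.sublist_cons_self _ _).trans (List.sublist_cons_self _ _)).trans hu
  · rintro ⟨r, hr, u, v, w, rfl, ⟨hru, g, hg, hgr, hs⟩, -, x, hx, hv⟩
    have hu : CanonicalFrom 0 u := by
      rw [List.append_assoc] at hπ
      exact ((canonicalFrom_append _ _ _).1 hπ).1
    have hx1 : 1 ≤ x := hπ.one_le (x := x) (by simp [hv.subset (show x ∈ _ by simp [singleIn])])
    let f : ℕ → ℕ := fun a => if a = 1 then x else if a = 2 then r else g a
    have f1 : f 1 = x := rfl
    have f2 : f 2 = r := rfl
    have fg (a : ℕ) (ha : a ∈ ρ) : f a = g a := by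
      have := hρ a ha
      simp only [f]
      rw [if_neg (by omega), if_neg (by omega)]
    refine ⟨f, ?_, ?_⟩
    · have key (c : ℕ) (hc : c ∈ 1 :: 2 :: ρ ++ singleIn 2 1 a b) : c = 1 ∨ c = 2 ∨ c ∈ ρ := by
        rcases List.mem_append.1 hc with hc | hc
        · simpa using hc
        · have := mem_singleIn hc
          tauto
      intro c hc d hd hcd
      rcases key c hc with rfl | rfl | hc <;> rcases key d hd with rfl | rfl | hd
      · omega
      · rwa [f1, f2]
      · rw [f1, fg d hd]
        exact hx.trans (hgr d hd)
      · omega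
      · omega
      · rw [f2, fg d hd]
        exact hgr d hd
      · have := hρ c hc
        omega
      · have := hρ c hc
        omega
      · rw [fg c hc, fg d hd]
        exact hg hc hd hcd
    · rw [List.map_append, map_singleIn, List.map_cons, List.map_cons, f1, f2,
        List.map_congr_left fg]
      refine List.Sublist.trans (List.Sublist.append ?_ hv) (List.sublist_append_left _ w)
      refine hu.append_sublist (t := [x, r]) (by simpa using hx) ?_ hs ?_
      · intro y hy
        simp only [List.mem_cons, List.not_mem_nil, or_false] at hy
        rcases hy with rfl | rfl
        · exact ⟨hu.mem_of_le hru hx1 hx.le, hx1⟩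
        · exact ⟨hru, hr⟩
      · intro y hy z hz
        obtain ⟨c, hc, rfl⟩ := List.mem_map.1 hz
        have := hgr c hc
        simp only [List.mem_cons, List.not_mem_nil, or_false] at hy
        omega

theorem le_apply_of_strictMonoOn {g : ℕ → ℕ} {j : ℕ} {s : Set ℕ} (hg : StrictMonoOn g s)
    (hs : ∀ i ≤ j, i + 2 ∈ s) : g 2 + j ≤ g (j + 2) := by
  induction j with
  | zero => simp
  | succ j ih =>
    have h1 := ih fun i hi => hs i (by omega)
    have h2 := hg (hs j (by omega)) (hs (j + 1) le_rfl) (by omega)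
    omega

theorem mem_iota {k a : ℕ} : a ∈ iota k ↔ 1 ≤ a ∧ a ≤ k := by
  simp only [iota, List.mem_map, List.mem_range]
  exact ⟨by omega, fun h => ⟨a - 1, by omega, by omega⟩⟩

theorem containsPat_copy_right_iff {ρ : List ℕ} {j : ℕ} (hρ : ∀ a ∈ ρ, j + 2 < a) (a b : ℕ)
    {π : List ℕ} (hπ : CanonicalFrom 0 π) :
    ContainsPat π (iota (j + 2) ++ singleIn 2 1 a b ++ ρ) ↔
      ∃ r, 1 ≤ r ∧
        OccursAt (fun r u => r + j ∈ u) (fun r w => HasCopyAbove ρ (r + j) w) a b r π := by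
  rw [containsPat_iff]
  constructor
  · rintro ⟨g, hg, hs⟩
    have hi (i : ℕ) (h1 : 1 ≤ i) (h2 : i ≤ j + 2) :
        i ∈ {c | c ∈ iota (j + 2) ++ singleIn 2 1 a b ++ ρ} := by
      show i ∈ _
      simp [mem_iota, h1, h2]
    have h12 : g 1 < g 2 := hg (hi 1 le_rfl (by omega)) (hi 2 (by omega) (by omega)) (by norm_num)
    have hj := le_apply_of_strictMonoOn (j := j) hg fun i h => hi (i + 2) (by omega) (by omega)
    rw [List.map_append, List.map_append, map_singleIn] at hs
    obtain ⟨l, w, rfl, hl, hw⟩ := List.append_sublist_iff.1 hs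
    obtain ⟨u, v, rfl, hu, hv⟩ := List.append_sublist_iff.1 hl
    refine ⟨g 2, by omega, u, v, w, rfl, ?_, ⟨g, ?_, ?_, hw⟩, g 1, h12, hv⟩
    · have hc : CanonicalFrom 0 u := by
        rw [List.append_assoc] at hπ
        exact ((canonicalFrom_append _ _ _).1 hπ).1
      refine hc.mem_of_le (hu.subset (List.mem_map_of_mem ?_)) (by omega) hj
      rw [mem_iota]
      omega
    · exact hg.mono fun x hx => by
        have hx' : x ∈ ρ := hx
        simp [hx']
    · exact fun x hx => hj.trans_lt (hg (hi (j + 2) (by omega) le_rfl) (by simp [hx]) (hρ x hx))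
  · rintro ⟨r, hr, u, v, w, rfl, hru, ⟨g, hg, hgr, hs⟩, x, hx, hv⟩
    have hu : CanonicalFrom 0 u := by
      rw [List.append_assoc] at hπ
      exact ((canonicalFrom_append _ _ _).1 hπ).1
    have hx1 : 1 ≤ x := hπ.one_le (x := x) (by simp [hv.subset (show x ∈ _ by simp [singleIn])])
    let f : ℕ → ℕ := fun a => if a = 1 then x else if a ≤ j + 2 then r + a - 2 else g a
    have f1 : f 1 = x := rfl
    have fi (a : ℕ) (ha : 2 ≤ a) (ha' : a ≤ j + 2) : f a = r + a - 2 := by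
      simp only [f]
      rw [if_neg (by omega), if_pos ha']
    have f2 : f 2 = r := by
      rw [fi 2 le_rfl (by omega)]
      omega
    have fg (a : ℕ) (ha : a ∈ ρ) : f a = g a := by
      have := hρ a ha
      simp only [f]
      rw [if_neg (by omega), if_neg (by omega)]
    have hf : StrictMonoOn f {c | c ∈ iota (j + 2) ++ singleIn 2 1 a b ++ ρ} := by
      have key (c : ℕ) (hc : c ∈ iota (j + 2) ++ singleIn 2 1 a b ++ ρ) :
          c = 1 ∨ (2 ≤ c ∧ c ≤ j + 2) ∨ c ∈ ρ := by
        rcases List.mem_append.1 hc with hc | hc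
        · rcases List.mem_append.1 hc with hc | hc
          · rw [mem_iota] at hc
            omega
          · have := mem_singleIn hc
            omega
        · exact Or.inr (Or.inr hc)
      intro c hc d hd hcd
      rcases key c hc with rfl | hc | hc <;> rcases key d hd with rfl | hd | hd
      · omega
      · rw [f1, fi d hd.1 hd.2]
        omega
      · have := hgr d hd
        rw [f1, fg d hd]
        omega
      · omega
      · rw [fi c hc.1 hc.2, fi d hd.1 hd.2]
        omega
      · have := hgr d hd
        rw [fi c hc.1 hc.2, fg d hd]
        omega
      · have := hρ c hc
        omega
      · have := hρ c hc
        omega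
      · rw [fg c hc, fg d hd]
        exact hg hc hd hcd
    refine ⟨f, hf, ?_⟩
    rw [List.map_append, List.map_append, map_singleIn, f1, f2, List.map_congr_left fg]
    refine List.Sublist.append (List.Sublist.append ?_ hv) hs
    have h := hu.append_sublist (t := (iota (j + 2)).map f) (s := []) ?_ ?_ (by simp) (by simp)
    · simpa using h
    · have hi : (iota (j + 2)).Pairwise (· < ·) := by
        rw [iota, List.pairwise_map]
        exact List.pairwise_lt_range.imp (by omega)
      rw [List.pairwise_map]
      refine hi.imp_of_mem fun {c d} hc hd hcd => hf ?_ ?_ hcd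
      · simp [hc]
      · simp [hd]
    · intro y hy
      obtain ⟨c, hc, rfl⟩ := List.mem_map.1 hy
      rw [mem_iota] at hc
      by_cases h1 : c = 1
      · subst h1
        exact ⟨hu.mem_of_le hru hx1 (by omega), hx1⟩
      · rw [fi c (by omega) hc.2]
        exact ⟨hu.mem_of_le hru (by omega) (by omega), by omega⟩

theorem iota_add_two (j : ℕ) : iota (j + 2) = 1 :: 2 :: (List.range j).map (· + 3) := by
  rw [iota, List.range_succ_eq_map, List.range_succ_eq_map]
  simp [Function.comp_def]

/-- For a canonical sequence τ, k ≥ 2 and p, q ≥ 0: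
1…k(τ+k)2^p12^q ∼ 1…k(τ+k)2^(p+q)1 and 1…k2^p12^q(τ+k) ∼ 1…k2^(p+q)1(τ+k). -/
theorem statement10 (τ : List ℕ) (hτ : IsCanonicalSeq τ) (k : ℕ) (hk : 2 ≤ k)
    (p q : ℕ) :
    PatEquiv (iota k ++ τ.map (· + k) ++ (List.replicate p 2 ++ 1 :: List.replicate q 2))
             (iota k ++ τ.map (· + k) ++ (List.replicate (p + q) 2 ++ [1])) ∧
    PatEquiv (iota k ++ (List.replicate p 2 ++ 1 :: List.replicate q 2) ++ τ.map (· + k))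
             (iota k ++ (List.replicate (p + q) 2 ++ [1]) ++ τ.map (· + k)) := by
  obtain ⟨j, rfl⟩ : ∃ j, k = j + 2 := ⟨k - 2, by omega⟩
  have hτ' : ∀ a ∈ τ.map (· + (j + 2)), j + 2 < a := by
    intro a ha
    obtain ⟨c, hc, rfl⟩ := List.mem_map.1 ha
    have := ((isCanonicalSeq_iff τ).1 hτ).one_le hc
    omega
  constructor
  · have hρ : ∀ a ∈ (List.range j).map (· + 3) ++ τ.map (· + (j + 2)), 2 < a := by
      intro a ha
      rcases List.mem_append.1 ha with ha | ha
      · obtain ⟨c, -, rfl⟩ := List.mem_map.1 ha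
        omega
      · have := hτ' a ha
        omega
    rw [iota_add_two]
    exact patEquiv_of_occursAt_iff (isFrame_copy_left _)
      (fun π hπ => containsPat_copy_left_iff hρ p q hπ)
      (fun π hπ => containsPat_copy_left_iff hρ (p + q) 0 hπ)
  · exact patEquiv_of_occursAt_iff (isFrame_copy_right _ j)
      (fun π hπ => containsPat_copy_right_iff hτ' p q hπ)
      (fun π hπ => containsPat_copy_right_iff hτ' (p + q) 0 hπ)
end

section
/- Let τ be the canonical sequence of a partition with exactly k blocks, and let p ≥ 1 and q ≥ 0 be integers. Then the pattern τ((1ᵖ21^q)+k) (that is, τ followed by p copies of k+1, then a single k+2, then q copies of k+1) is equivalent to the pattern τ((1^{p+q}2)+k) (that is, τ followed by p+q copies of k+1 and then a single k+2). -/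
namespace PartitionPattern

open List

/-! ### Patterns as images of strictly monotone maps -/

theorem containsPat_iff (π σ : List ℕ) :
    ContainsPat π σ ↔
      ∃ g : ℕ → ℕ, (∀ a ∈ σ, ∀ b ∈ σ, a < b → g a < g b) ∧ σ.map g <+ π := by
  constructor
  · rintro ⟨f, hf, h⟩
    have key : ∀ i j : Fin σ.length, σ.get i = σ.get j → π.get (f i) = π.get (f j) := by
      intro i j hij
      have h1 := h i j
      have h2 := h j i
      rw [hij] at h1 h2
      simp only [lt_irrefl, false_iff, not_lt] at h1 h2
      exact le_antisymm h2 h1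
    classical
    let g : ℕ → ℕ := fun a =>
      if ha : ∃ i : Fin σ.length, σ.get i = a then π.get (f ha.choose) else 0
    have hg : ∀ i, g (σ.get i) = π.get (f i) := by
      intro i
      have ha : ∃ j : Fin σ.length, σ.get j = σ.get i := ⟨i, rfl⟩
      simp only [g, dif_pos ha]
      exact key _ _ ha.choose_spec
    refine ⟨g, ?_, ?_⟩
    · intro a ha b hb hab
      obtain ⟨i, rfl⟩ := List.get_of_mem ha
      obtain ⟨j, rfl⟩ := List.get_of_mem hb
      rw [hg, hg]
      exact (h i j).1 hab
    · rw [List.sublist_iff_exists_fin_orderEmbedding_get_eq]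
      have hl : (σ.map g).length = σ.length := by simp
      refine ⟨OrderEmbedding.ofStrictMono (fun i => f (Fin.cast hl i))
        (fun i j hij => hf (by simpa using hij)), ?_⟩
      intro i
      have e : (σ.map g).get i = g (σ.get (Fin.cast hl i)) := by simp
      exact e.trans (hg _)
  · rintro ⟨g, hg, hs⟩
    rw [List.sublist_iff_exists_fin_orderEmbedding_get_eq] at hs
    obtain ⟨f, hf⟩ := hs
    have hl : σ.length = (σ.map g).length := by simp
    refine ⟨fun i => f (Fin.cast hl i), fun i j hij => f.strictMono (by simpa using hij), ?_⟩
    intro i j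
    rw [← hf, ← hf]
    have hi : σ.get i ∈ σ := List.get_mem _ _
    have hj : σ.get j ∈ σ := List.get_mem _ _
    have e : ∀ i, (σ.map g).get (Fin.cast hl i) = g (σ.get i) := by intro i; simp
    rw [e, e]
    refine ⟨hg _ hi _ hj, fun h => ?_⟩
    by_contra hn
    rcases (not_lt.1 hn).lt_or_eq with h' | h'
    · exact absurd (hg _ hj _ hi h') (by omega)
    · rw [h'] at h
      exact lt_irrefl _ h

/-- `τ` occurs in `α` using only values below `v`. -/
def OccursBelow (τ : List ℕ) (v : ℕ) (α : List ℕ) : Prop :=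
  ∃ g : ℕ → ℕ, (∀ a ∈ τ, ∀ b ∈ τ, a < b → g a < g b) ∧ (∀ a ∈ τ, g a < v) ∧ τ.map g <+ α

/-- `β` contains `p` copies of `v`, then a larger entry, then `q` copies of `v`. -/
def HasPeak (p q v : ℕ) (β : List ℕ) : Prop :=
  ∃ y, v < y ∧ replicate p v ++ y :: replicate q v <+ β

/-- `π` contains `τ` followed by a peak over the base value `v`, with `τ` below `v`. -/
def ContainsAt (τ : List ℕ) (p q v : ℕ) (π : List ℕ) : Prop :=
  ∃ α β, π = α ++ β ∧ OccursBelow τ v α ∧ HasPeak p q v β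

theorem containsPat_iff_exists_containsAt {τ : List ℕ} {k p q : ℕ} (hk : ∀ a ∈ τ, a ≤ k)
    (hp : 1 ≤ p) (π : List ℕ) :
    ContainsPat π (τ ++ replicate p (k + 1) ++ (k + 2) :: replicate q (k + 1)) ↔
      ∃ v, ContainsAt τ p q v π := by
  rw [containsPat_iff]
  constructor
  · rintro ⟨g, hg, hs⟩
    rw [List.append_assoc, List.map_append, List.append_sublist_iff] at hs
    obtain ⟨α, β, rfl, h1, h2⟩ := hs
    have m1 : k + 1 ∈ τ ++ replicate p (k + 1) ++ (k + 2) :: replicate q (k + 1) := by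
      simp; omega
    have m2 : k + 2 ∈ τ ++ replicate p (k + 1) ++ (k + 2) :: replicate q (k + 1) := by simp
    have m3 : ∀ a ∈ τ, a ∈ τ ++ replicate p (k + 1) ++ (k + 2) :: replicate q (k + 1) := by
      intro a ha; simp [ha]
    refine ⟨g (k + 1), α, β, rfl, ⟨g, fun a ha b hb => hg a (m3 a ha) b (m3 b hb), fun a ha => ?_,
      h1⟩, g (k + 2), hg _ m1 _ m2 (by omega), by simpa using h2⟩
    exact hg _ (m3 a ha) _ m1 (by have := hk a ha; omega)
  · rintro ⟨v, α, β, rfl, ⟨g, hg, hv, hs⟩, y, hy, hs'⟩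
    let g' : ℕ → ℕ := fun a => if a ≤ k then g a else if a = k + 1 then v else y
    have e1 : ∀ a ≤ k, g' a = g a := fun a ha => by simp [g', ha]
    have e2 : g' (k + 1) = v := by simp [g']
    have e3 : g' (k + 2) = y := by simp [g']
    refine ⟨g', ?_, ?_⟩
    · have cls : ∀ a ∈ τ ++ replicate p (k + 1) ++ (k + 2) :: replicate q (k + 1),
          a ∈ τ ∨ a = k + 1 ∨ a = k + 2 := by
        intro a ha
        simp only [mem_append, mem_replicate, mem_cons] at ha
        tauto
      intro a ha b hb hab
      rcases cls a ha with ha | rfl | rfl <;> rcases cls b hb with hb | rfl | rfl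
      · rw [e1 a (hk a ha), e1 b (hk b hb)]; exact hg a ha b hb hab
      · rw [e1 a (hk a ha), e2]; exact hv a ha
      · rw [e1 a (hk a ha), e3]; exact (hv a ha).trans hy
      · have := hk b hb; omega
      · omega
      · rw [e2, e3]; exact hy
      · have := hk b hb; omega
      · omega
      · omega
    · have e4 : τ.map g' = τ.map g := List.map_congr_left fun a ha => e1 a (hk a ha)
      rw [List.append_assoc, List.map_append, e4]
      refine hs.append ?_
      simpa [e2, e3] using hs'

theorem OccursBelow.mono {τ : List ℕ} {v w : ℕ} {α α' : List ℕ} (h : OccursBelow τ v α)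
    (hvw : v ≤ w) (hs : α <+ α') : OccursBelow τ w α' := by
  obtain ⟨g, h1, h2, h3⟩ := h
  exact ⟨g, h1, fun a ha => (h2 a ha).trans_le hvw, h3.trans hs⟩

theorem HasPeak.mono {p q v : ℕ} {β β' : List ℕ} (h : HasPeak p q v β) (hs : β <+ β') :
    HasPeak p q v β' := by
  obtain ⟨y, h1, h2⟩ := h
  exact ⟨y, h1, h2.trans hs⟩

theorem hasPeak_filter {p q v : ℕ} (β : List ℕ) :
    HasPeak p q v (β.filter (v ≤ ·)) ↔ HasPeak p q v β := by
  refine ⟨fun h => h.mono List.filter_sublist, ?_⟩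
  rintro ⟨y, hy, hs⟩
  refine ⟨y, hy, ?_⟩
  have := hs.filter (v ≤ ·)
  rwa [List.filter_eq_self.2] at this
  intro a ha
  simp only [mem_append, mem_replicate, mem_cons] at ha
  simp only [decide_eq_true_eq]
  omega

theorem hasPeak_iff_count {p q v : ℕ} (β : List ℕ) :
    HasPeak p q v β ↔
      ∃ β₁ y β₂, β = β₁ ++ y :: β₂ ∧ v < y ∧ p ≤ β₁.count v ∧ q ≤ β₂.count v := by
  constructor
  · rintro ⟨y, hy, hs⟩
    rw [List.append_sublist_iff] at hs
    obtain ⟨γ, δ, rfl, h1, h2⟩ := hs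
    rw [List.cons_sublist_iff] at h2
    obtain ⟨δ₁, δ₂, rfl, h3, h4⟩ := h2
    obtain ⟨ε₁, ε₂, rfl⟩ := List.append_of_mem h3
    refine ⟨γ ++ ε₁, y, ε₂ ++ δ₂, by simp, hy, ?_, ?_⟩
    · have := List.replicate_sublist_iff.1 h1
      rw [List.count_append]; omega
    · have := List.replicate_sublist_iff.1 h4
      rw [List.count_append]; omega
  · rintro ⟨β₁, y, β₂, rfl, hy, h1, h2⟩
    exact ⟨y, hy, (List.replicate_sublist_iff.2 h1).append
      ((List.replicate_sublist_iff.2 h2).cons_cons y)⟩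

/-! ### Truncating the entries of a word -/

theorem exists_filter_eq_and_map_min_eq (v : ℕ) (β z : List ℕ)
    (hl : z.length = (β.filter (v ≤ ·)).length) (hz : ∀ y ∈ z, v ≤ y) :
    ∃ β' : List ℕ, β'.filter (v ≤ ·) = z ∧ β'.map (min · v) = β.map (min · v) := by
  induction β generalizing z with
  | nil =>
    have : z = [] := by simpa using hl
    exact ⟨[], by simp [this]⟩
  | cons x β ih =>
    by_cases hx : v ≤ x
    · rw [List.filter_cons_of_pos (by simpa using hx)] at hl
      cases z with
      | nil => simp at hl
      | cons y z =>
        obtain ⟨β', h1, h2⟩ := ih z (by simpa using hl) fun a ha => hz a (by simp [ha])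
        have hy : v ≤ y := hz y (by simp)
        exact ⟨y :: β', by simp [hy, h1], by simp [h2, hx, hy]⟩
    · rw [List.filter_cons_of_neg (by simpa using hx)] at hl
      obtain ⟨β', h1, h2⟩ := ih z hl hz
      exact ⟨x :: β', by simp [hx, h1], by simp [h2]⟩

theorem eq_of_filter_eq_of_map_min_eq {v : ℕ} {β β' : List ℕ}
    (h : β.filter (v ≤ ·) = β'.filter (v ≤ ·)) (hm : β.map (min · v) = β'.map (min · v)) :
    β = β' := by
  induction β generalizing β' with
  | nil => simpa using hm.symm
  | cons x β ih =>
    cases β' with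
    | nil => simp at hm
    | cons x' β' =>
      simp only [List.map_cons, List.cons.injEq] at hm
      by_cases hx : v ≤ x
      · have hx' : v ≤ x' := by omega
        simp only [List.filter_cons, hx, hx', decide_true, if_true, List.cons.injEq] at h
        rw [h.1, ih h.2 hm.2]
      · have hx' : ¬ v ≤ x' := by omega
        simp only [List.filter_cons, hx, hx', decide_false] at h
        rw [ih (by simpa using h) hm.2]
        congr 1
        omega

theorem exists_sublist_map_min_eq {v : ℕ} {α α' l : List ℕ}
    (hm : α.map (min · v) = α'.map (min · v)) (hs : l <+ α) :
    ∃ l', l' <+ α' ∧ l.map (min · v) = l'.map (min · v) := by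
  have := hs.map (min · v)
  rw [hm, List.sublist_map_iff] at this
  obtain ⟨l', h1, h2⟩ := this
  exact ⟨l', h1, h2⟩

theorem eq_of_map_min_eq {v : ℕ} {l l' : List ℕ} (hm : l.map (min · v) = l'.map (min · v))
    (hl : ∀ a ∈ l, a < v) : l = l' := by
  induction l generalizing l' with
  | nil => simpa using hm.symm
  | cons x l ih =>
    cases l' with
    | nil => simp at hm
    | cons x' l' =>
      simp only [List.map_cons, List.cons.injEq] at hm
      have := hl x (by simp)
      rw [ih hm.2 fun a ha => hl a (by simp [ha])]
      congr 1
      omega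

theorem OccursBelow.of_map_min_eq {τ α α' : List ℕ} {v x : ℕ} (h : OccursBelow τ x α)
    (hx : x ≤ v) (hm : α.map (min · v) = α'.map (min · v)) : OccursBelow τ x α' := by
  obtain ⟨g, h1, h2, h3⟩ := h
  obtain ⟨l', h4, h5⟩ := exists_sublist_map_min_eq hm h3
  refine ⟨g, h1, h2, ?_⟩
  rwa [eq_of_map_min_eq h5]
  intro a ha
  obtain ⟨b, hb, rfl⟩ := List.mem_map.1 ha
  exact (h2 b hb).trans_le hx

theorem HasPeak.of_map_min_eq {p q v x : ℕ} {β β' : List ℕ} (h : HasPeak p q x β)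
    (hx : x < v) (hm : β.map (min · v) = β'.map (min · v)) : HasPeak p q x β' := by
  obtain ⟨y, hy, h⟩ := h
  obtain ⟨l', h4, h5⟩ := exists_sublist_map_min_eq hm h
  rw [List.map_append, eq_comm, List.map_eq_append_iff] at h5
  obtain ⟨l₁, l₂, rfl, h6, h7⟩ := h5
  rw [List.map_cons, List.map_eq_cons_iff] at h7
  obtain ⟨y', l₃, rfl, h8, h9⟩ := h7
  have h6 := eq_of_map_min_eq h6.symm (by simp; omega)
  have h9 := eq_of_map_min_eq h9.symm (by simp; omega)
  subst h6 h9
  exact ⟨y', by omega, h4⟩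

theorem ContainsAt.of_map_min_eq {τ π π' : List ℕ} {p q v x : ℕ} (h : ContainsAt τ p q x π)
    (hx : x < v) (hm : π.map (min · v) = π'.map (min · v)) : ContainsAt τ p q x π' := by
  obtain ⟨α, β, rfl, h1, h2⟩ := h
  rw [List.map_append, eq_comm, List.map_eq_append_iff] at hm
  obtain ⟨α', β', rfl, h3, h4⟩ := hm
  exact ⟨α', β', rfl, h1.of_map_min_eq hx.le h3.symm, h2.of_map_min_eq hx h4.symm⟩

/-! ### The shortest prefix containing `τ` below `v` -/

/-- `α ++ β` is cut after the shortest prefix containing `τ` below `v`; if there is no such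
prefix, then `β` is empty. -/
def IsCut (τ : List ℕ) (v : ℕ) (α β : List ℕ) : Prop :=
  (∀ γ, γ <+: α → γ ≠ α → ¬ OccursBelow τ v γ) ∧ (β ≠ [] → OccursBelow τ v α)

theorem exists_isCut (τ : List ℕ) (v : ℕ) (π : List ℕ) :
    ∃ α β, π = α ++ β ∧ IsCut τ v α β := by
  induction π using List.reverseRecOn with
  | nil => exact ⟨[], [], rfl, fun γ h h' => absurd (List.prefix_nil.1 h) h', by simp⟩
  | append_singleton l x ih =>
    obtain ⟨α, β, rfl, h1, h2⟩ := ih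
    by_cases ho : OccursBelow τ v α
    · exact ⟨α, β ++ [x], by simp, h1, fun _ => ho⟩
    · have hβ : β = [] := by
        by_contra hβ
        exact ho (h2 hβ)
      subst hβ
      refine ⟨α ++ [x], [], by simp, fun γ h h' => ?_, by simp⟩
      rcases List.prefix_concat_iff.1 h with h | h
      · exact absurd h (by simpa using h')
      · by_cases e : γ = α
        · rwa [e]
        · exact h1 γ h e

theorem IsCut.eq_of_append_eq {τ α β α₁ β₁ : List ℕ} {v : ℕ} (h : IsCut τ v α β)
    (h₁ : IsCut τ v α₁ β₁) (he : α ++ β = α₁ ++ β₁) : α = α₁ ∧ β = β₁ := by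
  rcases List.append_eq_append_iff.1 he with ⟨γ, e1, e2⟩ | ⟨γ, e1, e2⟩
  · by_cases hγ : γ = []
    · subst hγ; simp_all
    · exact absurd (h.2 (by simp [e2, hγ])) (h₁.1 α ⟨γ, e1.symm⟩ (by simp [e1, hγ]))
  · by_cases hγ : γ = []
    · subst hγ; simp_all
    · exact absurd (h₁.2 (by simp [e2, hγ])) (h.1 α₁ ⟨γ, e1.symm⟩ (by simp [e1, hγ]))

theorem IsCut.congr {τ α β β' : List ℕ} {v : ℕ} (h : IsCut τ v α β)
    (hl : β.length = β'.length) : IsCut τ v α β' := by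
  refine ⟨h.1, fun hβ => h.2 ?_⟩
  rintro rfl
  exact hβ (List.length_eq_zero_iff.1 hl.symm)

theorem IsCut.containsAt_iff {τ α β : List ℕ} {p q v : ℕ} (h : IsCut τ v α β) :
    ContainsAt τ p q v (α ++ β) ↔ HasPeak p q v β := by
  constructor
  · rintro ⟨α₁, β₁, he, h1, h2⟩
    rcases List.append_eq_append_iff.1 he with ⟨γ, e1, e2⟩ | ⟨γ, e1, e2⟩
    · exact h2.mono (e2 ▸ List.sublist_append_right _ _)
    · by_cases hγ : γ = []
      · subst hγ; simp_all
      · exact absurd h1 (h.1 α₁ ⟨γ, e1.symm⟩ (by simp [e1, hγ]))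
  · intro h1
    refine ⟨α, β, rfl, h.2 ?_, h1⟩
    rintro rfl
    obtain ⟨y, -, h1⟩ := h1
    simpa using h1.length_le

theorem HasPeak.of_filter_lt_eq {p q v x : ℕ} {β β' : List ℕ} (h : HasPeak p q x β)
    (hx : v < x) (hf : β.filter (v < ·) = β'.filter (v < ·)) : HasPeak p q x β' := by
  have e : ∀ l : List ℕ, l.filter (x ≤ ·) = (l.filter (v < ·)).filter (x ≤ ·) := by
    intro l
    rw [List.filter_filter]
    refine List.filter_congr fun a _ => ?_
    simp only [← Bool.decide_and, decide_eq_decide]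
    omega
  rw [← hasPeak_filter, e, ← hf, ← e, hasPeak_filter]
  exact h

theorem IsCut.containsAt_of_lt {τ α β β' : List ℕ} {p q v x : ℕ} (hc : IsCut τ v α β)
    (h : ContainsAt τ p q x (α ++ β)) (hx : v < x) (hl : β.length = β'.length)
    (hf : β.filter (v < ·) = β'.filter (v < ·)) : ContainsAt τ p q x (α ++ β') := by
  obtain ⟨α₁, β₁, he, h1, h2⟩ := h
  rcases List.append_eq_append_iff.1 he with ⟨γ, e1, e2⟩ | ⟨γ, e1, e2⟩
  · have h3 : HasPeak p q x β := h2.mono (e2 ▸ List.sublist_append_right _ _)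
    refine ⟨α, β', rfl, (hc.2 ?_).mono hx.le (List.Sublist.refl _), h3.of_filter_lt_eq hx hf⟩
    rintro rfl
    obtain ⟨y, -, h3⟩ := h3
    simpa using h3.length_le
  · subst e1 e2
    refine ⟨α₁, γ ++ β', by simp, h1, h2.of_filter_lt_eq hx ?_⟩
    rw [List.filter_append, List.filter_append, hf]

/-! ### Moving the copies of `v` -/

/-- `z` and `z'` agree, except that if `v` occurs at least `p + q` times, then all but
`p + q - 1` of its copies directly follow the `p`-th one in `z`, and end the word `z'`. -/
def Shift (p q v : ℕ) (z z' : List ℕ) : Prop :=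
  (z = z' ∧ z.count v < p + q) ∨
    ∃ a b e, a.count v + 1 = p ∧ b.count v + 1 = q ∧
      z = a ++ v :: (replicate (e + 1) v ++ b) ∧ z' = a ++ v :: (b ++ replicate (e + 1) v)

theorem Shift.perm {p q v : ℕ} {z z' : List ℕ} (h : Shift p q v z z') : z ~ z' := by
  rcases h with ⟨rfl, -⟩ | ⟨a, b, e, -, -, rfl, rfl⟩
  · exact List.Perm.refl _
  · exact (List.perm_append_comm.cons _).append_left _

theorem Shift.filter_lt_eq {p q v : ℕ} {z z' : List ℕ} (h : Shift p q v z z') :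
    z.filter (v < ·) = z'.filter (v < ·) := by
  rcases h with ⟨rfl, -⟩ | ⟨a, b, e, -, -, rfl, rfl⟩
  · rfl
  · simp

theorem Shift.head?_eq {p q v : ℕ} {z z' : List ℕ} (h : Shift p q v z z') :
    z.head? = z'.head? := by
  rcases h with ⟨rfl, -⟩ | ⟨a, b, e, -, -, rfl, rfl⟩
  · rfl
  · cases a <;> simp

theorem append_cons_inj_of_count_eq {v : ℕ} {a a' b b' : List ℕ} (hc : a.count v = a'.count v)
    (h : a ++ v :: b = a' ++ v :: b') : a = a' ∧ b = b' := by
  induction a generalizing a' with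
  | nil =>
    cases a' with
    | nil => simpa using h
    | cons x a' =>
      simp only [List.nil_append, List.cons_append, List.cons.injEq] at h
      rw [← h.1] at hc
      simp at hc
  | cons x a ih =>
    cases a' with
    | nil =>
      simp only [List.nil_append, List.cons_append, List.cons.injEq] at h
      rw [h.1] at hc
      simp at hc
    | cons x' a' =>
      simp only [List.cons_append, List.cons.injEq] at h
      obtain ⟨rfl, h⟩ := h
      rw [List.count_cons, List.count_cons] at hc
      obtain ⟨rfl, rfl⟩ := ih (by omega) h
      exact ⟨rfl, rfl⟩

theorem exists_append_cons_of_lt_count {v n : ℕ} {z : List ℕ} (h : n < z.count v) :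
    ∃ a b, z = a ++ v :: b ∧ a.count v = n := by
  induction z generalizing n with
  | nil => simp at h
  | cons x z ih =>
    by_cases hx : x = v
    · subst hx
      cases n with
      | zero => exact ⟨[], z, by simp⟩
      | succ n =>
        obtain ⟨a, b, rfl, hc⟩ := ih (n := n) (by simpa using h)
        exact ⟨x :: a, b, by simp, by simp [hc]⟩
    · obtain ⟨a, b, rfl, hc⟩ := ih (n := n) (by rwa [List.count_cons_of_ne hx] at h)
      exact ⟨x :: a, b, by simp, by rw [List.count_cons_of_ne hx, hc]⟩

theorem exists_append_cons_of_lt_count' {v n : ℕ} {z : List ℕ} (h : n < z.count v) :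
    ∃ a b, z = a ++ v :: b ∧ b.count v = n := by
  obtain ⟨a, b, e, hc⟩ := exists_append_cons_of_lt_count (z := z.reverse) (n := n) (v := v)
    (by simpa using h)
  refine ⟨b.reverse, a.reverse, ?_, by simpa using hc⟩
  rw [← List.reverse_reverse z, e]
  simp

theorem Shift.right_unique {p q v : ℕ} {z z₁ z₂ : List ℕ} (h₁ : Shift p q v z z₁)
    (h₂ : Shift p q v z z₂) : z₁ = z₂ := by
  rcases h₁ with ⟨rfl, h⟩ | ⟨a, b, e, ha, hb, rfl, rfl⟩ <;>
    rcases h₂ with ⟨h2, h'⟩ | ⟨a', b', e', ha', hb', h2, rfl⟩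
  · exact h2
  · subst h2
    simp only [List.count_append, List.count_cons_self, List.count_replicate_self] at h
    omega
  · simp only [List.count_append, List.count_cons_self, List.count_replicate_self] at h'
    omega
  · have hc := congrArg (List.count v) h2
    simp only [List.count_append, List.count_cons_self, List.count_replicate_self] at hc
    obtain rfl : e = e' := by omega
    obtain ⟨rfl, h3⟩ := append_cons_inj_of_count_eq (by omega) h2
    rw [List.append_cancel_left h3]

theorem Shift.left_unique {p q v : ℕ} {z z₁ z₂ : List ℕ} (h₁ : Shift p q v z₁ z)
    (h₂ : Shift p q v z₂ z) : z₁ = z₂ := by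
  rcases h₁ with ⟨rfl, h⟩ | ⟨a, b, e, ha, hb, rfl, rfl⟩ <;>
    rcases h₂ with ⟨h2, h'⟩ | ⟨a', b', e', ha', hb', rfl, h2⟩
  · exact h2.symm
  · subst h2
    simp only [List.count_append, List.count_cons_self, List.count_replicate_self] at h
    omega
  · subst h2
    simp only [List.count_append, List.count_cons_self, List.count_replicate_self] at h'
    omega
  · have hc := congrArg (List.count v) h2
    simp only [List.count_append, List.count_cons_self, List.count_replicate_self] at hc
    obtain rfl : e = e' := by omega
    obtain ⟨rfl, h3⟩ := append_cons_inj_of_count_eq (by omega) h2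
    rw [List.append_cancel_right h3]

theorem Shift.not_hasPeak_left {p q v : ℕ} {z z' : List ℕ} (h : Shift p q v z z') :
    ¬ HasPeak p q v z := by
  rw [hasPeak_iff_count]
  rintro ⟨β₁, y, β₂, e, hy, h1, h2⟩
  rcases h with ⟨rfl, h⟩ | ⟨a, b, n, ha, hb, rfl, rfl⟩
  · rw [e, List.count_append, List.count_cons_of_ne hy.ne'] at h
    omega
  · rcases List.append_eq_append_iff.1 e with ⟨γ, rfl, e2⟩ | ⟨γ, rfl, e2⟩
    · rw [← List.cons_append, ← List.replicate_succ] at e2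
      rcases List.append_eq_append_iff.1 e2 with ⟨δ, rfl, e4⟩ | ⟨δ, e3, e4⟩
      · rw [e4, List.count_append, List.count_cons] at hb
        omega
      · cases δ with
        | nil =>
          simp only [List.nil_append] at e4
          rw [← e4, List.count_cons] at hb
          omega
        | cons w δ =>
          simp only [List.cons_append, List.cons.injEq] at e4
          have : y ∈ replicate (n + 1 + 1) v := by rw [e3, ← e4.1]; simp
          exact absurd (List.eq_of_mem_replicate this) hy.ne'
    · rw [List.count_append] at ha
      omega

theorem Shift.not_hasPeak_right {p q v : ℕ} {z z' : List ℕ} (h : Shift p q v z z') :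
    ¬ HasPeak (p + q) 0 v z' := by
  rw [hasPeak_iff_count]
  rintro ⟨β₁, y, β₂, e, hy, h1, -⟩
  rcases h with ⟨rfl, h⟩ | ⟨a, b, n, ha, hb, rfl, rfl⟩
  · rw [e, List.count_append] at h
    omega
  · rw [← List.cons_append, ← List.append_assoc] at e
    rcases List.append_eq_append_iff.1 e with ⟨γ, rfl, e2⟩ | ⟨γ, e1, e2⟩
    · have : y ∈ replicate (n + 1) v := by rw [e2]; simp
      exact absurd (List.eq_of_mem_replicate this) hy.ne'
    · have := congrArg (List.count v) e1
      rw [List.count_append, List.count_append, List.count_cons_self] at this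
      omega

theorem exists_shift_left {p q v : ℕ} (hp : 1 ≤ p) (hq : 1 ≤ q) {z : List ℕ}
    (hz : ∀ y ∈ z, v ≤ y) (h : ¬ HasPeak p q v z) : ∃ z', Shift p q v z z' := by
  by_cases hc : z.count v < p + q
  · exact ⟨z, Or.inl ⟨rfl, hc⟩⟩
  obtain ⟨a, w, rfl, ha⟩ := exists_append_cons_of_lt_count (z := z) (v := v) (n := p - 1)
    (by omega)
  rw [List.count_append, List.count_cons_self] at hc
  obtain ⟨c, b, rfl, hb⟩ := exists_append_cons_of_lt_count' (z := w) (v := v) (n := q - 1)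
    (by omega)
  have hcv : c = replicate c.length v := by
    rw [List.eq_replicate_iff]
    refine ⟨rfl, fun y hy => ?_⟩
    by_contra hne
    have hvy : v ≤ y := hz y (by simp [hy])
    obtain ⟨c₁, c₂, rfl⟩ := List.append_of_mem hy
    refine h ((hasPeak_iff_count _).2 ⟨a ++ v :: c₁, y, c₂ ++ v :: b, by simp, by omega, ?_, ?_⟩)
    · rw [List.count_append, List.count_cons_self]; omega
    · rw [List.count_append, List.count_cons_self]; omega
  refine ⟨_, Or.inr ⟨a, b, c.length, by omega, by omega, ?_, rfl⟩⟩
  rw [List.replicate_succ', ← hcv]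
  simp

theorem exists_shift_right {p q v : ℕ} (hp : 1 ≤ p) (hq : 1 ≤ q) {z' : List ℕ}
    (hz : ∀ y ∈ z', v ≤ y) (h : ¬ HasPeak (p + q) 0 v z') : ∃ z, Shift p q v z z' := by
  by_cases hc : z'.count v < p + q
  · exact ⟨z', Or.inl ⟨rfl, hc⟩⟩
  obtain ⟨a, w, rfl, ha⟩ := exists_append_cons_of_lt_count (z := z') (v := v) (n := p - 1)
    (by omega)
  rw [List.count_append, List.count_cons_self] at hc
  obtain ⟨b, c, rfl, hb⟩ := exists_append_cons_of_lt_count (z := w) (v := v) (n := q - 1)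
    (by omega)
  have hcv : c = replicate c.length v := by
    rw [List.eq_replicate_iff]
    refine ⟨rfl, fun y hy => ?_⟩
    by_contra hne
    have hvy : v ≤ y := hz y (by simp [hy])
    obtain ⟨c₁, c₂, rfl⟩ := List.append_of_mem hy
    refine h ((hasPeak_iff_count _).2
      ⟨a ++ v :: b ++ v :: c₁, y, c₂, by simp, by omega, ?_, by omega⟩)
    simp only [List.count_append, List.count_cons_self]
    omega
  refine ⟨_, Or.inr ⟨a, b, c.length, by omega, by omega, rfl, ?_⟩⟩
  rw [List.replicate_succ, ← hcv]

/-! ### Canonical sequences -/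

theorem foldr_max_le_iff (l : List ℕ) (k : ℕ) : l.foldr max 0 ≤ k ↔ ∀ a ∈ l, a ≤ k := by
  induction l with
  | nil => simp
  | cons x l ih => simp [ih]

theorem isCanonicalSeq_iff (π : List ℕ) :
    IsCanonicalSeq π ↔
      (∀ y ∈ π, 1 ≤ y) ∧ ∀ v, 1 ≤ v → ∀ y ∈ (π.filter (v ≤ ·)).head?, y = v := by
  constructor
  · intro h
    refine ⟨fun y hy => ?_, fun v hv y hy => ?_⟩
    · obtain ⟨i, rfl⟩ := List.get_of_mem hy
      exact (h i i.2).1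
    · obtain ⟨t, ht⟩ := List.head?_eq_some_iff.1 hy
      obtain ⟨l₁, l₂, rfl, h1, h2, -⟩ := List.filter_eq_cons_iff.1 ht
      have h3 := (h l₁.length (by simp)).2
      have h4 : l₁.foldr max 0 ≤ v - 1 := by
        rw [foldr_max_le_iff]
        intro a ha
        have := h1 a ha
        simp only [decide_eq_true_eq] at this
        omega
      simp only [decide_eq_true_eq] at h2
      simp at h3
      omega
  · rintro ⟨h1, h2⟩ i hi
    refine ⟨h1 _ (List.get_mem _ _), ?_⟩
    by_contra hlt
    set m := (π.take i).foldr max 0 with hm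
    have h3 := h2 (m + 1) (by omega) π[i] ?_
    · simp only [List.get_eq_getElem] at hlt
      omega
    · have e : π = π.take i ++ π[i] :: π.drop (i + 1) := by simp
      have h4 : (π.take i).filter (m + 1 ≤ ·) = [] := by
        rw [List.filter_eq_nil_iff]
        intro a ha
        have := (foldr_max_le_iff _ _).1 hm.ge a ha
        simp only [decide_eq_true_eq]
        omega
      conv_lhs => rw [e]
      simp only [List.get_eq_getElem] at hlt
      rw [List.filter_append, h4, List.filter_cons_of_pos (by simp only [decide_eq_true_eq]; omega)]
      simp

theorem le_length_of_isCanonicalSeq {π : List ℕ} (h : IsCanonicalSeq π) {x : ℕ} (hx : x ∈ π) :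
    x ≤ π.length := by
  rw [isCanonicalSeq_iff] at h
  have hs : Finset.Icc 1 x ⊆ π.toFinset := by
    intro w hw
    rw [Finset.mem_Icc] at hw
    rw [List.mem_toFinset]
    have hmem : x ∈ π.filter (w ≤ ·) := by simp [hx, hw.2]
    cases hf : π.filter (w ≤ ·) with
    | nil => simp [hf] at hmem
    | cons y t =>
      have hy := h.2 w hw.1 y (by simp [hf])
      have : y ∈ π.filter (w ≤ ·) := by simp [hf]
      rw [hy] at this
      exact (List.mem_filter.1 this).1
  have := (Finset.card_le_card hs).trans π.toFinset_card_le
  simpa using this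

theorem isCanonicalSeq_append_congr {α β β' : List ℕ} {v : ℕ} (hv : 1 ≤ v)
    (h : IsCanonicalSeq (α ++ β)) (hm : β.map (min · v) = β'.map (min · v))
    (hf : β.filter (v < ·) = β'.filter (v < ·))
    (hh : (β.filter (v ≤ ·)).head? = (β'.filter (v ≤ ·)).head?) :
    IsCanonicalSeq (α ++ β') := by
  rw [isCanonicalSeq_iff] at h ⊢
  refine ⟨fun y hy => ?_, fun x hx y hy => ?_⟩
  · rcases List.mem_append.1 hy with hy | hy
    · exact h.1 y (by simp [hy])
    · have : min y v ∈ β.map (min · v) := hm ▸ List.mem_map_of_mem hy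
      obtain ⟨w, hw, e⟩ := List.mem_map.1 this
      have := h.1 w (by simp [hw])
      omega
  rcases lt_trichotomy x v with hxv | rfl | hxv
  · have e : ∀ l : List ℕ, (l.filter (x ≤ ·)).map (min · v) =
        (l.map (min · v)).filter (x ≤ ·) := by
      intro l
      rw [List.filter_map]
      congr 1
      refine List.filter_congr fun a _ => ?_
      simp only [Function.comp, decide_eq_decide]
      omega
    have e2 : ((α ++ β).filter (x ≤ ·)).map (min · v) =
        ((α ++ β').filter (x ≤ ·)).map (min · v) := by
      rw [e, e, List.map_append, List.map_append, hm]
    have e3 := congrArg List.head? e2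
    rw [List.head?_map, List.head?_map, Option.mem_def.1 hy] at e3
    obtain ⟨w, hw, e4⟩ := Option.map_eq_some_iff.1 e3
    have := h.2 x hx w hw
    simp only at e4
    omega
  · refine h.2 x hx y ?_
    rw [List.filter_append, List.head?_append] at hy ⊢
    rwa [hh]
  · have e : ∀ l : List ℕ, l.filter (x ≤ ·) = (l.filter (v < ·)).filter (x ≤ ·) := by
      intro l
      rw [List.filter_filter]
      refine List.filter_congr fun a _ => ?_
      simp only [← Bool.decide_and, decide_eq_decide]
      omega
    refine h.2 x hx y ?_
    rwa [List.filter_append, e β, hf, ← e, ← List.filter_append]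

/-! ### Exchanging the two patterns over one base value -/

/-- `π'` is obtained from `π` by shifting copies of `v` behind the shortest prefix containing
`τ` below `v`. -/
def ShiftAt (τ : List ℕ) (p q v : ℕ) (π π' : List ℕ) : Prop :=
  ∃ α β β', π = α ++ β ∧ π' = α ++ β' ∧ IsCut τ v α β ∧
    β.map (min · v) = β'.map (min · v) ∧
    Shift p q v (β.filter (v ≤ ·)) (β'.filter (v ≤ ·))

/-- Canonical sequences of length `n` which avoid the `(p + q, 0)`-peaks over base values up to
`j`, and the `(p, q)`-peaks over larger base values. -/
def Hybrid (τ : List ℕ) (p q n j : ℕ) : Set (List ℕ) :=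
  {π | π.length = n ∧ IsCanonicalSeq π ∧
    (∀ x, 1 ≤ x → x ≤ j → ¬ ContainsAt τ (p + q) 0 x π) ∧
    ∀ x, j < x → ¬ ContainsAt τ p q x π}

theorem filter_lt_eq_filter_filter (v : ℕ) (l : List ℕ) :
    l.filter (v < ·) = (l.filter (v ≤ ·)).filter (v < ·) := by
  rw [List.filter_filter]
  refine List.filter_congr fun a _ => ?_
  simp only [← Bool.decide_and, decide_eq_decide]
  omega

theorem exists_shiftAt_left {τ π : List ℕ} {p q n j : ℕ} (hp : 1 ≤ p) (hq : 1 ≤ q)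
    (h : π ∈ Hybrid τ p q n j) :
    ∃ π' ∈ Hybrid τ p q n (j + 1), ShiftAt τ p q (j + 1) π π' := by
  obtain ⟨hl, hcan, hlo, hhi⟩ := h
  obtain ⟨α, β, rfl, hcut⟩ := exists_isCut τ (j + 1) π
  have h1 := hhi (j + 1) (by omega)
  rw [hcut.containsAt_iff, ← hasPeak_filter] at h1
  obtain ⟨z', hz'⟩ := exists_shift_left hp hq (by simp) h1
  obtain ⟨β', rfl, hm⟩ := exists_filter_eq_and_map_min_eq (j + 1) β z' hz'.perm.length_eq.symm
    (fun y hy => by simpa using (List.mem_filter.1 (hz'.perm.mem_iff.2 hy)).2)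
  have hlen : β.length = β'.length := by simpa using (congrArg List.length hm).symm
  have hf : β.filter (j + 1 < ·) = β'.filter (j + 1 < ·) := by
    rw [filter_lt_eq_filter_filter, hz'.filter_lt_eq, ← filter_lt_eq_filter_filter]
  have hcut' := hcut.congr hlen
  refine ⟨α ++ β', ⟨by simpa [← hlen] using hl,
    isCanonicalSeq_append_congr (by omega) hcan hm.symm hf hz'.head?_eq, fun x hx hxj hc => ?_, fun x hx hc => ?_⟩,
    α, β, β', rfl, rfl, hcut, hm.symm, hz'⟩
  · rcases hxj.lt_or_eq with hxj | rfl
    · exact hlo x hx (by omega) (hc.of_map_min_eq hxj (by simp [hm]))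
    · rw [hcut'.containsAt_iff, ← hasPeak_filter] at hc
      exact hz'.not_hasPeak_right hc
  · exact hhi x (by omega) (hcut'.containsAt_of_lt hc hx hlen.symm hf.symm)

theorem exists_shiftAt_right {τ π' : List ℕ} {p q n j : ℕ} (hp : 1 ≤ p) (hq : 1 ≤ q)
    (h : π' ∈ Hybrid τ p q n (j + 1)) :
    ∃ π ∈ Hybrid τ p q n j, ShiftAt τ p q (j + 1) π π' := by
  obtain ⟨hl, hcan, hlo, hhi⟩ := h
  obtain ⟨α, β', rfl, hcut'⟩ := exists_isCut τ (j + 1) π'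
  have h1 := hlo (j + 1) (by omega) le_rfl
  rw [hcut'.containsAt_iff, ← hasPeak_filter] at h1
  obtain ⟨z, hz⟩ := exists_shift_right hp hq (by simp) h1
  obtain ⟨β, rfl, hm⟩ := exists_filter_eq_and_map_min_eq (j + 1) β' z hz.perm.length_eq
    (fun y hy => by simpa using (List.mem_filter.1 (hz.perm.mem_iff.1 hy)).2)
  have hlen : β.length = β'.length := by simpa using congrArg List.length hm
  have hf : β.filter (j + 1 < ·) = β'.filter (j + 1 < ·) := by
    rw [filter_lt_eq_filter_filter, hz.filter_lt_eq, ← filter_lt_eq_filter_filter]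
  have hcut := hcut'.congr hlen.symm
  refine ⟨α ++ β, ⟨by simpa [hlen] using hl,
    isCanonicalSeq_append_congr (by omega) hcan hm.symm hf.symm hz.head?_eq.symm, fun x hx hxj hc => ?_,
    fun x hx hc => ?_⟩, α, β, β', rfl, rfl, hcut, hm, hz⟩
  · exact hlo x hx (by omega) (hc.of_map_min_eq (v := j + 1) (by omega) (by simp [hm]))
  · rcases (Nat.succ_le_of_lt hx).lt_or_eq with hx | rfl
    · exact hhi x hx (hcut.containsAt_of_lt hc hx hlen hf)
    · rw [Nat.succ_eq_add_one, hcut.containsAt_iff, ← hasPeak_filter] at hc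
      exact hz.not_hasPeak_left hc

theorem ShiftAt.right_unique {τ π π₁ π₂ : List ℕ} {p q v : ℕ} (h₁ : ShiftAt τ p q v π π₁)
    (h₂ : ShiftAt τ p q v π π₂) : π₁ = π₂ := by
  obtain ⟨α, β, β₁, rfl, rfl, hc, hm, hs⟩ := h₁
  obtain ⟨α', β', β₂, he, rfl, hc', hm', hs'⟩ := h₂
  obtain ⟨rfl, rfl⟩ := hc.eq_of_append_eq hc' he
  rw [eq_of_filter_eq_of_map_min_eq (hs.right_unique hs') (hm.symm.trans hm')]

theorem ShiftAt.left_unique {τ π π₁ π₂ : List ℕ} {p q v : ℕ} (h₁ : ShiftAt τ p q v π₁ π)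
    (h₂ : ShiftAt τ p q v π₂ π) : π₁ = π₂ := by
  obtain ⟨α, β₁, β, rfl, rfl, hc, hm, hs⟩ := h₁
  obtain ⟨α', β₂, β', rfl, he, hc', hm', hs'⟩ := h₂
  obtain ⟨rfl, rfl⟩ := (hc.congr (by simpa using congrArg List.length hm)).eq_of_append_eq
    (hc'.congr (by simpa using congrArg List.length hm')) he
  rw [eq_of_filter_eq_of_map_min_eq (hs.left_unique hs') (hm.trans hm'.symm)]

theorem ncard_eq_of_rel {X : Type*} {A B : Set X} (R : X → X → Prop)
    (hA : ∀ a ∈ A, ∃ b ∈ B, R a b) (hB : ∀ b ∈ B, ∃ a ∈ A, R a b)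
    (hr : ∀ a b b', R a b → R a b' → b = b') (hl : ∀ a a' b, R a b → R a' b → a = a') :
    A.ncard = B.ncard := by
  choose f hfB hfR using hA
  refine Set.ncard_congr f hfB (fun a a' ha ha' h => ?_) fun b hb => ?_
  · exact hl a a' _ (hfR a ha) (h ▸ hfR a' ha')
  · obtain ⟨a, ha, hab⟩ := hB b hb
    exact ⟨a, ha, hr a _ _ (hfR a ha) hab⟩

theorem ncard_hybrid_eq {τ : List ℕ} {p q : ℕ} (hp : 1 ≤ p) (hq : 1 ≤ q) (n j : ℕ) :
    (Hybrid τ p q n 0).ncard = (Hybrid τ p q n j).ncard := by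
  induction j with
  | zero => rfl
  | succ j ih =>
    exact ih.trans (ncard_eq_of_rel (ShiftAt τ p q (j + 1))
      (fun _ ha => exists_shiftAt_left hp hq ha) (fun _ hb => exists_shiftAt_right hp hq hb)
      (fun _ _ _ => ShiftAt.right_unique) fun _ _ _ => ShiftAt.left_unique)

theorem ContainsAt.mem {τ π : List ℕ} {p q v : ℕ} (hp : 1 ≤ p) (h : ContainsAt τ p q v π) :
    v ∈ π := by
  obtain ⟨α, β, rfl, -, y, -, hs⟩ := h
  exact List.mem_append_right _ (hs.subset (by simp; omega))

theorem ContainsAt.base_pos {τ π : List ℕ} {p q v : ℕ} (hp : 1 ≤ p)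
    (h : ContainsAt τ p q v π) (hπ : IsCanonicalSeq π) : 1 ≤ v :=
  ((isCanonicalSeq_iff π).1 hπ).1 v (h.mem hp)

end PartitionPattern

open PartitionPattern

/-- For a canonical sequence τ with exactly k blocks (its
maximum entry is k), p ≥ 1 and q ≥ 0, the pattern τ((1^p21^q)+k) is
equivalent to the pattern τ((1^(p+q)2)+k). -/
theorem statement11 (τ : List ℕ) (hτ : IsCanonicalSeq τ) (k : ℕ)
    (hk : τ.foldr max 0 = k) (p q : ℕ) (hp : 1 ≤ p) :
    PatEquiv (τ ++ List.replicate p (k + 1) ++ (k + 2) :: List.replicate q (k + 1))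
             (τ ++ List.replicate (p + q) (k + 1) ++ [k + 2]) := by
  rcases Nat.eq_zero_or_pos q with rfl | hq
  · exact fun n => rfl
  have hτk := (foldr_max_le_iff τ k).1 hk.le
  intro n
  have hA : {π : List ℕ | π.length = n ∧ IsCanonicalSeq π ∧
      AvoidsPat π (τ ++ List.replicate p (k + 1) ++ (k + 2) :: List.replicate q (k + 1))} =
      Hybrid τ p q n 0 := by
    ext π
    simp only [Set.mem_ofPred_eq, Hybrid, AvoidsPat, containsPat_iff_exists_containsAt hτk hp]
    refine and_congr_right fun _ => and_congr_right fun hπ => ⟨fun h => ⟨?_, ?_⟩, ?_⟩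
    · intros; omega
    · exact fun x _ hx => h ⟨x, hx⟩
    · rintro ⟨-, h⟩ ⟨x, hx⟩
      exact h x (hx.base_pos hp hπ) hx
  have hB : {π : List ℕ | π.length = n ∧ IsCanonicalSeq π ∧
      AvoidsPat π (τ ++ List.replicate (p + q) (k + 1) ++ [k + 2])} =
      Hybrid τ p q n n := by
    ext π
    have e := containsPat_iff_exists_containsAt (q := 0) hτk (le_add_right hp : 1 ≤ p + q) π
    rw [List.replicate_zero] at e
    simp only [Set.mem_ofPred_eq, Hybrid, AvoidsPat, e]
    refine and_congr_right fun hl => and_congr_right fun hπ => ⟨fun h => ⟨?_, ?_⟩, ?_⟩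
    · exact fun x _ _ hx => h ⟨x, hx⟩
    · intro x hx hc
      have := le_length_of_isCanonicalSeq hπ (hc.mem hp)
      omega
    · rintro ⟨h, -⟩ ⟨x, hx⟩
      have hx1 := hx.base_pos (by omega) hπ
      have := le_length_of_isCanonicalSeq hπ (hx.mem (by omega))
      exact h x hx1 (by omega) hx
  rw [pAvoid, pAvoid, hA, hB]
  exact ncard_hybrid_eq hp hq n n
end

section
/- Let k ≥ 1, let T be an arbitrary (possibly empty) sequence over the alphabet {1,…,k}, and let p ≥ 1 and q ≥ 0 be integers. Then the pattern 12⋯k((1ᵖ21^q)+k)T is equivalent to the pattern 12⋯k((1^{p+q}2)+k)T; here (1ᵖ21^q)+k is the sequence consisting of p copies of k+1, a single k+2, and q copies of k+1, and (1^{p+q}2)+k consists of p+q copies of k+1 followed by a single k+2. -/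
namespace PatternPartition

/-- Truncation of all letters at height `b`. -/
def low (b : ℕ) (D : List ℕ) : List ℕ := D.map (min b)

/-- For the letters of `D` that are at least `b`, record which ones are equal to `b`. -/
def mask (b : ℕ) (D : List ℕ) : List Bool :=
  (D.filter (fun x => decide (b ≤ x))).map (fun x => decide (x = b))

/-- The letters of `D` exceeding `b`. -/
def big (b : ℕ) (D : List ℕ) : List ℕ := D.filter (fun x => decide (b < x))

/-- Reassemble a sequence from its truncation, its mask and its large letters. -/
def build (b : ℕ) : List ℕ → List Bool → List ℕ → List ℕ
  | [], _, _ => []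
  | l :: ls, [], g => l :: build b ls [] g
  | l :: ls, true :: m, g =>
    if l < b then l :: build b ls (true :: m) g else b :: build b ls m g
  | l :: ls, false :: m, [] => l :: build b ls (false :: m) []
  | l :: ls, false :: m, x :: g =>
    if l < b then l :: build b ls (false :: m) (x :: g) else x :: build b ls m g

theorem build_cons_of_lt {b l : ℕ} (h : l < b) (ls : List ℕ) (m : List Bool) (g : List ℕ) :
    build b (l :: ls) m g = l :: build b ls m g := by
  rcases m with _ | ⟨_ | _, m⟩ <;> rcases g with _ | ⟨x, g⟩ <;> simp [build, h]

theorem low_append (b : ℕ) (D E : List ℕ) : low b (D ++ E) = low b D ++ low b E := by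
  simp [low]

theorem big_append (b : ℕ) (D E : List ℕ) : big b (D ++ E) = big b D ++ big b E := by
  simp [big]

theorem low_cons (b x : ℕ) (D : List ℕ) : low b (x :: D) = min b x :: low b D := rfl

theorem length_low (b : ℕ) (D : List ℕ) : (low b D).length = D.length := by simp [low]

theorem mask_cons (b x : ℕ) (D : List ℕ) :
    mask b (x :: D) = if b ≤ x then decide (x = b) :: mask b D else mask b D := by
  by_cases h : b ≤ x <;> simp [mask, h]

theorem big_cons (b x : ℕ) (D : List ℕ) :
    big b (x :: D) = if b < x then x :: big b D else big b D := by
  by_cases h : b < x <;> simp [big, h]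

theorem build_self (b : ℕ) (D : List ℕ) : build b (low b D) (mask b D) (big b D) = D := by
  induction D with
  | nil => rfl
  | cons x D ih =>
    rw [low_cons, mask_cons, big_cons]
    rcases lt_trichotomy x b with h | rfl | h
    · rw [min_eq_right h.le, if_neg (by omega), if_neg (by omega), build_cons_of_lt h, ih]
    · simp [build, ih]
    · rw [if_pos h.le, if_pos h, min_eq_left h.le, decide_eq_false (by omega)]
      simp [build, ih]

theorem build_spec (b : ℕ) (ls : List ℕ) : ∀ (m : List Bool) (g : List ℕ),
    (∀ l ∈ ls, l ≤ b) → ls.count b = m.length → m.count false = g.length → (∀ x ∈ g, b < x) →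
    low b (build b ls m g) = ls ∧ mask b (build b ls m g) = m ∧ big b (build b ls m g) = g := by
  induction ls with
  | nil =>
    intro m g _ hm hg _
    obtain rfl : m = [] := List.length_eq_zero_iff.1 (by simpa using hm.symm)
    obtain rfl : g = [] := List.length_eq_zero_iff.1 (by simpa using hg.symm)
    simp [build, low, mask, big]
  | cons l ls ih =>
    intro m g hl hm hg hx
    have hls : ∀ l ∈ ls, l ≤ b := fun y hy => hl y (List.mem_cons_of_mem _ hy)
    rcases (hl l List.mem_cons_self).lt_or_eq with h | rfl
    · rw [List.count_cons_of_ne (by omega)] at hm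
      obtain ⟨h1, h2, h3⟩ := ih m g hls hm hg hx
      rw [build_cons_of_lt h, low_cons, mask_cons, big_cons, if_neg (by omega),
        if_neg (by omega), min_eq_right h.le, h1]
      exact ⟨rfl, h2, h3⟩
    · rw [List.count_cons_self] at hm
      rcases m with _ | ⟨_ | _, m⟩
      · simp at hm
      · rcases g with _ | ⟨x, g⟩
        · simp at hg
        · obtain ⟨h1, h2, h3⟩ := ih m g hls (by simpa using hm) (by simpa using hg)
            (fun y hy => hx y (List.mem_cons_of_mem _ hy))
          have hlx : l < x := hx x List.mem_cons_self
          simp [build, low_cons, mask_cons, big_cons, h1, h2, h3, hlx, hlx.le, hlx.ne']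
      · obtain ⟨h1, h2, h3⟩ := ih m g hls (by simpa using hm) (by simpa using hg) hx
        simp [build, low_cons, mask_cons, big_cons, h1, h2, h3]

/-- Reverse the pattern of the letters `b` among all letters that are at least `b`, keeping
the order of the larger letters and the positions of the smaller ones. -/
def flip (b : ℕ) (D : List ℕ) : List ℕ := build b (low b D) (mask b D).reverse (big b D)

theorem count_low (b : ℕ) (D : List ℕ) : (low b D).count b = (mask b D).length := by
  induction D with
  | nil => rfl
  | cons x D ih =>
    rw [low_cons, mask_cons]
    by_cases h : b ≤ x
    · simp [h, ih]
    · rw [if_neg h, List.count_cons_of_ne (by omega), ih]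

theorem count_mask (b : ℕ) (D : List ℕ) : (mask b D).count false = (big b D).length := by
  induction D with
  | nil => rfl
  | cons x D ih =>
    rw [mask_cons, big_cons]
    rcases lt_trichotomy x b with h | rfl | h
    · rw [if_neg (by omega), if_neg (by omega), ih]
    · simp [ih]
    · simp [h, h.le, h.ne', ih]

theorem flip_spec (b : ℕ) (D : List ℕ) :
    low b (flip b D) = low b D ∧ mask b (flip b D) = (mask b D).reverse ∧
      big b (flip b D) = big b D := by
  apply build_spec
  · intro l hl
    obtain ⟨y, -, rfl⟩ := List.mem_map.1 hl
    exact min_le_left _ _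
  · rw [count_low, List.length_reverse]
  · rw [List.count_reverse, count_mask]
  · intro x hx
    simpa using (List.mem_filter.1 hx).2

theorem flip_flip (b : ℕ) (D : List ℕ) : flip b (flip b D) = D := by
  obtain ⟨h1, h2, h3⟩ := flip_spec b D
  rw [flip, h1, h2, h3, List.reverse_reverse, build_self]

/-- Apply `flip b` to the part of the sequence following the `p`-th occurrence of `b`. -/
def flipAfter (b : ℕ) : ℕ → List ℕ → List ℕ
  | 0, D => flip b D
  | _ + 1, [] => []
  | p + 1, x :: D => x :: if x = b then flipAfter b p D else flipAfter b (p + 1) D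

theorem flipAfter_flipAfter (b p : ℕ) (D : List ℕ) : flipAfter b p (flipAfter b p D) = D := by
  induction D generalizing p with
  | nil => cases p <;> rfl
  | cons x D ih =>
    cases p with
    | zero => simp only [flipAfter, flip_flip]
    | succ p => by_cases h : x = b <;> simp [flipAfter, h, ih]

theorem low_flipAfter (b p : ℕ) (D : List ℕ) : low b (flipAfter b p D) = low b D := by
  induction D generalizing p with
  | nil => cases p <;> rfl
  | cons x D ih =>
    cases p with
    | zero => exact (flip_spec b _).1
    | succ p => by_cases h : x = b <;> simp [flipAfter, h, ih, low_cons]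

theorem big_flipAfter (b p : ℕ) (D : List ℕ) : big b (flipAfter b p D) = big b D := by
  induction D generalizing p with
  | nil => cases p <;> rfl
  | cons x D ih =>
    cases p with
    | zero => exact (flip_spec b _).2.2
    | succ p => by_cases h : x = b <;> simp [flipAfter, h, ih, big_cons]

theorem find_flipAfter (b p : ℕ) (hp : 1 ≤ p) (D : List ℕ) :
    (flipAfter b p D).find? (fun x => decide (b ≤ x)) = D.find? (fun x => decide (b ≤ x)) := by
  obtain ⟨p, rfl⟩ : ∃ p', p = p' + 1 := ⟨p - 1, by omega⟩
  induction D with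
  | nil => rfl
  | cons x D ih =>
    by_cases h : x = b
    · simp [flipAfter, h]
    · simp [flipAfter, h, ih, List.find?_cons]

theorem length_flipAfter (b p : ℕ) (D : List ℕ) : (flipAfter b p D).length = D.length := by
  rw [← length_low b, low_flipAfter, length_low]

theorem sublist_mask_cons (b q : ℕ) (D : List ℕ) :
    (∃ x, b < x ∧ (x :: List.replicate q b).Sublist D) ↔
      (false :: List.replicate q true).Sublist (mask b D) := by
  constructor
  · rintro ⟨x, hx, h⟩
    have := (h.filter (fun x => decide (b ≤ x))).map (fun x => decide (x = b))
    simpa [hx.le, hx.ne', mask] using this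
  · intro h
    obtain ⟨L, hL, e⟩ := List.sublist_map_iff.1 h
    rcases L with _ | ⟨x, L⟩
    · simp at e
    · have hxm := (List.mem_filter.1 (hL.subset List.mem_cons_self)).2
      rw [List.map_cons, List.cons.injEq] at e
      have hx : b < x := by
        have h1 : b ≤ x := by simpa using hxm
        have h2 : ¬ x = b := by simpa using e.1
        omega
      refine ⟨x, hx, ?_⟩
      have : L = List.replicate q b := by
        rw [List.eq_replicate_iff]
        have e2 := e.2.symm
        rw [List.eq_replicate_iff] at e2
        simpa using e2
      rw [← this]
      exact hL.trans List.filter_sublist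

theorem sublist_mask_concat (b q : ℕ) (D : List ℕ) :
    (∃ x, b < x ∧ (List.replicate q b ++ [x]).Sublist D) ↔
      (List.replicate q true ++ [false]).Sublist (mask b D) := by
  have h := sublist_mask_cons b q D.reverse
  have e : mask b D.reverse = (mask b D).reverse := by
    simp [mask, List.filter_reverse]
  rw [e, ← List.reverse_sublist, List.reverse_reverse] at h
  simp only [List.reverse_cons, List.reverse_replicate] at h
  rw [← h]
  refine exists_congr fun x => and_congr_right fun _ => ?_
  rw [← List.reverse_sublist]
  simp

theorem flipAfter_occurrence (b p q : ℕ) (D : List ℕ) :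
    (∃ x, b < x ∧ (List.replicate p b ++ x :: List.replicate q b).Sublist D) ↔
      ∃ x, b < x ∧ (List.replicate (p + q) b ++ [x]).Sublist (flipAfter b p D) := by
  induction D generalizing p with
  | nil =>
    cases p with
    | zero => simp [flipAfter, flip, low, build]
    | succ p => simp [flipAfter]
  | cons y D ih =>
    cases p with
    | zero =>
      simp only [List.replicate_zero, List.nil_append, Nat.zero_add, flipAfter]
      rw [sublist_mask_cons, sublist_mask_concat, (flip_spec b _).2.1, ← List.reverse_sublist]
      simp
    | succ p =>
      rw [show p + 1 + q = p + q + 1 by omega]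
      simp only [List.replicate_succ, List.cons_append, flipAfter]
      by_cases h : y = b
      · subst h
        simp only [if_true, List.cons_sublist_cons]
        exact ih p
      · have hb : ∀ L E : List ℕ, (b :: L).Sublist (y :: E) ↔ (b :: L).Sublist E := fun L E =>
          ⟨fun hs => by
            cases hs with
            | cons _ h' => exact h'
            | cons_cons => exact absurd rfl h, fun hs => hs.cons y⟩
        simp only [if_neg h, hb]
        have := ih (p + 1)
        rw [show p + 1 + q = p + q + 1 by omega] at this
        simpa only [List.replicate_succ, List.cons_append] using this

/-- The values `a 1 < ⋯ < a k` are positive and less than `b`. -/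
def Admissible (k b : ℕ) (a : ℕ → ℕ) : Prop :=
  StrictMonoOn a (Set.Icc 1 k) ∧ ∀ i ∈ Set.Icc 1 k, 1 ≤ a i ∧ a i < b

/-- `D` contains a copy of `T` using `k` positive values less than `b`. -/
def HasTail (k : ℕ) (T : List ℕ) (b : ℕ) (D : List ℕ) : Prop :=
  ∃ a, Admissible k b a ∧ (T.map a).Sublist D

/-- `π` contains `u` copies of `b`, a larger letter and `v` copies of `b`, followed by a copy of
`T` on letters less than `b`. -/
def Occurs (k : ℕ) (T : List ℕ) (u v b : ℕ) (π : List ℕ) : Prop :=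
  ∃ x, b < x ∧ ∃ a, Admissible k b a ∧
    (List.replicate u b ++ x :: List.replicate v b ++ T.map a).Sublist π

open Classical in
/-- The last position after which a copy of `T` on letters less than `b` remains. -/
noncomputable def cut (k : ℕ) (T : List ℕ) (b : ℕ) (π : List ℕ) : ℕ :=
  Nat.findGreatest (fun i => HasTail k T b (π.drop i)) π.length

/-- The row operation exchanging the two avoidance conditions for the letter `b`. -/
noncomputable def swap (k : ℕ) (T : List ℕ) (p b : ℕ) (π : List ℕ) : List ℕ :=
  flipAfter b p (π.take (cut k T b π)) ++ π.drop (cut k T b π)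

theorem Admissible.mono {k b c : ℕ} {a : ℕ → ℕ} (h : Admissible k b a) (hbc : b ≤ c) :
    Admissible k c a :=
  ⟨h.1, fun i hi => ⟨(h.2 i hi).1, (h.2 i hi).2.trans_le hbc⟩⟩

theorem eq_of_low_eq {b : ℕ} {L M : List ℕ} (hM : ∀ x ∈ M, x < b) (h : low b L = low b M) :
    L = M := by
  induction M generalizing L with
  | nil => simpa [low] using h
  | cons x M ih =>
    rcases L with _ | ⟨y, L⟩
    · simp [low] at h
    · rw [low_cons, low_cons, List.cons.injEq] at h
      have := hM x List.mem_cons_self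
      rw [ih (fun z hz => hM z (List.mem_cons_of_mem _ hz)) h.2]
      have : y = x := by omega
      rw [this]

theorem exists_sublist_of_low_eq {b : ℕ} {L D E : List ℕ} (hL : L.Sublist D)
    (h : low b D = low b E) : ∃ M : List ℕ, M.Sublist E ∧ low b M = low b L := by
  have h1 : (low b L).Sublist (low b E) := h ▸ hL.map _
  obtain ⟨M, hM, e⟩ := List.sublist_map_iff.1 h1
  exact ⟨M, hM, e.symm⟩

variable {k : ℕ} {T : List ℕ}

theorem Admissible.tail_lt {b : ℕ} {a : ℕ → ℕ} (h : Admissible k b a)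
    (hT : ∀ x ∈ T, 1 ≤ x ∧ x ≤ k) : ∀ x ∈ T.map a, x < b := by
  intro x hx
  obtain ⟨y, hy, rfl⟩ := List.mem_map.1 hx
  exact (h.2 y (hT y hy)).2

theorem HasTail.of_low_eq (hT : ∀ x ∈ T, 1 ≤ x ∧ x ≤ k) {b : ℕ} {D E : List ℕ}
    (h : low b D = low b E) (hD : HasTail k T b D) : HasTail k T b E := by
  obtain ⟨a, ha, hs⟩ := hD
  obtain ⟨M, hM, e⟩ := exists_sublist_of_low_eq hs h
  exact ⟨a, ha, eq_of_low_eq (ha.tail_lt hT) e ▸ hM⟩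

theorem HasTail.mono {b : ℕ} {D E : List ℕ} (h : D.Sublist E) (hD : HasTail k T b D) :
    HasTail k T b E := by
  obtain ⟨a, ha, hs⟩ := hD
  exact ⟨a, ha, hs.trans h⟩

theorem low_drop (b i : ℕ) (D : List ℕ) : low b (D.drop i) = (low b D).drop i := by
  simp [low, List.map_drop]

theorem low_swap (k : ℕ) (T : List ℕ) (p b : ℕ) (π : List ℕ) :
    low b (swap k T p b π) = low b π := by
  rw [swap, low_append, low_flipAfter, ← low_append, List.take_append_drop]

theorem length_swap (k : ℕ) (T : List ℕ) (p b : ℕ) (π : List ℕ) :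
    (swap k T p b π).length = π.length := by
  rw [← length_low b, low_swap, length_low]

theorem cut_swap (hT : ∀ x ∈ T, 1 ≤ x ∧ x ≤ k) (p b : ℕ) (π : List ℕ) :
    cut k T b (swap k T p b π) = cut k T b π := by
  rw [cut, cut, length_swap]
  congr 1
  funext i
  have h : low b ((swap k T p b π).drop i) = low b (π.drop i) := by
    rw [low_drop, low_swap, low_drop]
  exact propext ⟨HasTail.of_low_eq hT h, HasTail.of_low_eq hT h.symm⟩

theorem cut_le (k : ℕ) (T : List ℕ) (b : ℕ) (π : List ℕ) : cut k T b π ≤ π.length := by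
  classical
  exact Nat.findGreatest_le _

theorem take_cut_swap (k : ℕ) (T : List ℕ) (p b : ℕ) (π : List ℕ) :
    (swap k T p b π).take (cut k T b π) = flipAfter b p (π.take (cut k T b π)) := by
  refine List.take_left' ?_
  rw [length_flipAfter, List.length_take, min_eq_left (cut_le k T b π)]

theorem drop_cut_swap (k : ℕ) (T : List ℕ) (p b : ℕ) (π : List ℕ) :
    (swap k T p b π).drop (cut k T b π) = π.drop (cut k T b π) := by
  refine List.drop_left' ?_
  rw [length_flipAfter, List.length_take, min_eq_left (cut_le k T b π)]

theorem swap_swap (hT : ∀ x ∈ T, 1 ≤ x ∧ x ≤ k) (p b : ℕ) (π : List ℕ) :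
    swap k T p b (swap k T p b π) = π := by
  rw [swap, cut_swap hT, take_cut_swap, drop_cut_swap, flipAfter_flipAfter,
    List.take_append_drop]

theorem le_cut {b i : ℕ} {π : List ℕ} (hi : i ≤ π.length) (h : HasTail k T b (π.drop i)) :
    i ≤ cut k T b π := by
  classical
  exact Nat.le_findGreatest (P := fun i => HasTail k T b (π.drop i)) hi h

theorem hasTail_drop_cut {b : ℕ} {π : List ℕ} (h : HasTail k T b π) :
    HasTail k T b (π.drop (cut k T b π)) := by
  classical
  exact Nat.findGreatest_spec (P := fun i => HasTail k T b (π.drop i)) (Nat.zero_le _) h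

theorem occurs_iff (u v b : ℕ) (π : List ℕ) :
    Occurs k T u v b π ↔ HasTail k T b π ∧ ∃ x, b < x ∧
      (List.replicate u b ++ x :: List.replicate v b).Sublist (π.take (cut k T b π)) := by
  constructor
  · rintro ⟨x, hx, a, ha, hs⟩
    obtain ⟨D, E, rfl, h1, h2⟩ := List.append_sublist_iff.1 hs
    have hE : HasTail k T b E := ⟨a, ha, h2⟩
    refine ⟨hE.mono (List.sublist_append_right _ _), x, hx, ?_⟩
    have hle : D.length ≤ cut k T b (D ++ E) := le_cut (by simp) (by simpa using hE)
    refine h1.trans ?_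
    rw [List.take_append, List.take_of_length_le hle]
    exact List.sublist_append_left _ _
  · rintro ⟨h, x, hx, hs⟩
    obtain ⟨a, ha, ht⟩ := hasTail_drop_cut h
    refine ⟨x, hx, a, ha, ?_⟩
    have := hs.append ht
    rwa [List.take_append_drop] at this

theorem hasTail_swap (hT : ∀ x ∈ T, 1 ≤ x ∧ x ≤ k) (p b : ℕ) (π : List ℕ) :
    HasTail k T b (swap k T p b π) ↔ HasTail k T b π :=
  ⟨HasTail.of_low_eq hT (low_swap k T p b π), HasTail.of_low_eq hT (low_swap k T p b π).symm⟩

theorem occurs_swap_same (hT : ∀ x ∈ T, 1 ≤ x ∧ x ≤ k) (p q b : ℕ) (π : List ℕ) :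
    Occurs k T (p + q) 0 b (swap k T p b π) ↔ Occurs k T p q b π := by
  rw [occurs_iff, occurs_iff, hasTail_swap hT, cut_swap hT, take_cut_swap, flipAfter_occurrence b p q]
  rfl

theorem occurs_of_low_eq (hT : ∀ x ∈ T, 1 ≤ x ∧ x ≤ k) {u v b c : ℕ} (hcb : c < b)
    {π ρ : List ℕ} (h : low b π = low b ρ) (ho : Occurs k T u v c π) : Occurs k T u v c ρ := by
  obtain ⟨x, hx, a, ha, hs⟩ := ho
  obtain ⟨M, hM, e⟩ := exists_sublist_of_low_eq hs h
  rw [low_append, low_append, low_cons] at e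
  obtain ⟨M₁, M₂, rfl, e₁, e₂⟩ := List.map_eq_append_iff.1 e
  obtain ⟨M₃, M₄, rfl, e₃, e₄⟩ := List.map_eq_append_iff.1 e₁
  obtain ⟨y, M₅, rfl, e₅, e₆⟩ := List.map_eq_cons_iff.1 e₄
  have hr : ∀ w, ∀ z ∈ List.replicate w c, z < b := fun w z hz => by
    rwa [List.eq_of_mem_replicate hz]
  rw [eq_of_low_eq (hr _) e₃, eq_of_low_eq (hr _) e₆,
    eq_of_low_eq (fun z hz => (ha.tail_lt hT z hz).trans hcb) e₂] at hM
  exact ⟨y, by omega, a, ha, hM⟩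

theorem sublist_of_big_eq {b : ℕ} {L D E : List ℕ} (hL : ∀ x ∈ L, b < x) (hs : L.Sublist D)
    (h : big b D = big b E) : L.Sublist E := by
  have h1 : big b L = L := List.filter_eq_self.2 fun x hx => by simpa using hL x hx
  have h2 : (big b L).Sublist (big b D) := hs.filter _
  rw [h1, h] at h2
  exact h2.trans List.filter_sublist

theorem occurs_swap_of_lt (u v p : ℕ) {b c : ℕ} (hbc : b < c) {π : List ℕ}
    (ho : Occurs k T u v c π) : Occurs k T u v c (swap k T p b π) := by
  obtain ⟨x, hx, a, ha, hs⟩ := ho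
  obtain ⟨D, E, rfl, h1, h2⟩ := List.append_sublist_iff.1 hs
  have hL : ∀ z ∈ List.replicate u c ++ x :: List.replicate v c, b < z := by
    intro z hz
    simp only [List.mem_append, List.mem_cons, List.mem_replicate] at hz
    omega
  set r := cut k T b (D ++ E) with hr
  rcases le_total r D.length with hle | hle
  · have e : swap k T p b (D ++ E) = (flipAfter b p (D.take r) ++ D.drop r) ++ E := by
      rw [swap, ← hr, List.take_append_of_le_length hle, List.drop_append_of_le_length hle,
        List.append_assoc]
    refine ⟨x, hx, a, ha, ?_⟩
    rw [e]
    refine (sublist_of_big_eq hL h1 ?_).append h2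
    rw [big_append, big_flipAfter, ← big_append, List.take_append_drop]
  · have h1' : (List.replicate u c ++ x :: List.replicate v c).Sublist
        (flipAfter b p ((D ++ E).take r)) := by
      refine sublist_of_big_eq hL ?_ (big_flipAfter b p _).symm
      refine h1.trans ?_
      rw [List.take_append, List.take_of_length_le hle]
      exact List.sublist_append_left _ _
    by_cases ht : HasTail k T b (D ++ E)
    · obtain ⟨a', ha', ht'⟩ := hasTail_drop_cut ht
      exact ⟨x, hx, a', ha'.mono hbc.le, h1'.append ht'⟩
    · have h0 : r = 0 := by
        classical
        rw [hr, cut, Nat.findGreatest_eq_zero_iff]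
        intro n _ _ hn
        exact ht (hn.mono (List.drop_sublist _ _))
      have := h1'.length_le
      rw [length_flipAfter, h0] at this
      simp at this

theorem occurs_swap_of_ne (hT : ∀ x ∈ T, 1 ≤ x ∧ x ≤ k) (u v p : ℕ) {b c : ℕ} (hbc : c ≠ b)
    (π : List ℕ) : Occurs k T u v c (swap k T p b π) ↔ Occurs k T u v c π := by
  rcases hbc.lt_or_gt with h | h
  · exact ⟨occurs_of_low_eq hT h (low_swap k T p b π),
      occurs_of_low_eq hT h (low_swap k T p b π).symm⟩
  · refine ⟨fun ho => ?_, occurs_swap_of_lt u v p h⟩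
    have := occurs_swap_of_lt u v p h ho
    rwa [swap_swap hT] at this

/-- Reformulation of `IsCanonicalSeq`: the first letter that is at least `c` is `c`. -/
def FirstLetters (π : List ℕ) : Prop :=
  (∀ x ∈ π, 1 ≤ x) ∧
    ∀ c, 1 ≤ c → ∀ x, π.find? (fun y => decide (c ≤ y)) = some x → x = c

theorem le_foldr_max {x : ℕ} {π : List ℕ} (h : x ∈ π) : x ≤ π.foldr max 0 := by
  induction π with
  | nil => simp at h
  | cons y π ih =>
    rw [List.foldr_cons]
    rcases List.mem_cons.1 h with rfl | h
    · exact le_max_left _ _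
    · exact (ih h).trans (le_max_right _ _)

theorem foldr_max_mem {π : List ℕ} (h : 1 ≤ π.foldr max 0) : π.foldr max 0 ∈ π := by
  induction π with
  | nil => simp at h
  | cons y π ih =>
    rw [List.foldr_cons] at h ⊢
    rcases le_total (π.foldr max 0) y with hy | hy
    · rw [max_eq_left hy]
      exact List.mem_cons_self
    · rw [max_eq_right hy] at h ⊢
      exact List.mem_cons_of_mem _ (ih h)

theorem isCanonicalSeq_concat (π : List ℕ) (y : ℕ) :
    IsCanonicalSeq (π ++ [y]) ↔ IsCanonicalSeq π ∧ 1 ≤ y ∧ y ≤ π.foldr max 0 + 1 := by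
  simp only [IsCanonicalSeq, List.get_eq_getElem]
  constructor
  · intro h
    refine ⟨fun i hi => ?_, ?_⟩
    · have := h i (by simp; omega)
      rwa [List.getElem_append_left hi, List.take_append_of_le_length hi.le] at this
    · simpa using h π.length (by simp)
  · rintro ⟨h, hy⟩ i hi
    rcases Nat.lt_or_ge i π.length with hlt | hge
    · rw [List.getElem_append_left hlt, List.take_append_of_le_length hlt.le]
      exact h i hlt
    · obtain rfl : i = π.length := by
        simp at hi
        omega
      simpa using hy

theorem firstLetters_concat (π : List ℕ) (y : ℕ) :
    FirstLetters (π ++ [y]) ↔ FirstLetters π ∧ 1 ≤ y ∧ y ≤ π.foldr max 0 + 1 := by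
  constructor
  · rintro ⟨h1, h2⟩
    refine ⟨⟨fun x hx => h1 x (by simp [hx]), fun c hc x hx => h2 c hc x (by simp [hx])⟩,
      h1 y (by simp), ?_⟩
    by_contra! hlt
    have hn : π.find? (fun z => decide (π.foldr max 0 + 1 ≤ z)) = none := by
      rw [List.find?_eq_none]
      intro x hx
      have := le_foldr_max hx
      simp only [decide_eq_true_eq]
      omega
    have := h2 (π.foldr max 0 + 1) (by omega) y (by
      rw [List.find?_append, hn]
      simp
      omega)
    omega
  · rintro ⟨⟨h1, h2⟩, hy⟩
    refine ⟨fun x hx => ?_, fun c hc x hx => ?_⟩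
    · rcases List.mem_append.1 hx with hx | hx
      · exact h1 x hx
      · rw [List.mem_singleton.1 hx]
        exact hy.1
    · rw [List.find?_append] at hx
      cases hf : π.find? (fun z => decide (c ≤ z)) with
      | some z =>
        rw [hf] at hx
        simp only [Option.some_or, Option.some.injEq] at hx
        exact hx ▸ h2 c hc z hf
      | none =>
        rw [hf] at hx
        simp only [Option.none_or] at hx
        have hxy : x = y := by simpa using List.mem_of_find?_eq_some hx
        have hcx : c ≤ x := by simpa using List.find?_some hx
        have hall : π.foldr max 0 < c := by
          by_contra! hle
          have := List.find?_eq_none.1 hf _ (foldr_max_mem (hc.trans hle))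
          simp only [decide_eq_true_eq] at this
          exact this hle
        omega

theorem isCanonicalSeq_iff (π : List ℕ) : IsCanonicalSeq π ↔ FirstLetters π := by
  induction π using List.reverseRecOn with
  | nil => simp [IsCanonicalSeq, FirstLetters]
  | append_singleton π y ih => rw [isCanonicalSeq_concat, firstLetters_concat, ih]

theorem find_low {b c : ℕ} (h : c ≤ b) (D : List ℕ) :
    (low b D).find? (fun y => decide (c ≤ y)) =
      (D.find? (fun y => decide (c ≤ y))).map (min b) := by
  rw [low, List.find?_map]
  congr 2
  funext y
  simp [Function.comp, h]

theorem find_big {b c : ℕ} (h : b < c) (D : List ℕ) :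
    (big b D).find? (fun y => decide (c ≤ y)) = D.find? (fun y => decide (c ≤ y)) := by
  rw [big, List.find?_filter]
  congr 1
  funext y
  by_cases hy : c ≤ y
  · simp [hy, h.trans_le hy]
  · simp [hy]

theorem big_swap (k : ℕ) (T : List ℕ) (p b : ℕ) (π : List ℕ) :
    big b (swap k T p b π) = big b π := by
  rw [swap, big_append, big_flipAfter, ← big_append, List.take_append_drop]

theorem find_swap (k : ℕ) (T : List ℕ) {p : ℕ} (hp : 1 ≤ p) (b : ℕ) (π : List ℕ) :
    (swap k T p b π).find? (fun y => decide (b ≤ y)) = π.find? (fun y => decide (b ≤ y)) := by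
  rw [swap, List.find?_append, find_flipAfter b p hp, ← List.find?_append,
    List.take_append_drop]

theorem FirstLetters.swap {π : List ℕ} {p : ℕ} (hp : 1 ≤ p) {b : ℕ} (hb : 1 ≤ b)
    (h : FirstLetters π) : FirstLetters (swap k T p b π) := by
  obtain ⟨h1, h2⟩ := h
  refine ⟨fun x hx => ?_, fun c hc x hx => ?_⟩
  · have : min b x ∈ low b (PatternPartition.swap k T p b π) := List.mem_map_of_mem hx
    rw [low_swap] at this
    obtain ⟨y, hy, e⟩ := List.mem_map.1 this
    have := h1 y hy
    omega
  · rcases lt_trichotomy c b with hcb | rfl | hcb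
    · have e := find_low hcb.le (PatternPartition.swap k T p b π)
      rw [low_swap, find_low hcb.le, hx, Option.map_some, Option.map_eq_some_iff] at e
      obtain ⟨y, hy, e⟩ := e
      have := h2 c hc y hy
      omega
    · rw [find_swap k T hp] at hx
      exact h2 c hc x hx
    · rw [← find_big hcb, big_swap, find_big hcb] at hx
      exact h2 c hc x hx

theorem isCanonicalSeq_swap (hT : ∀ x ∈ T, 1 ≤ x ∧ x ≤ k) {p : ℕ} (hp : 1 ≤ p) {b : ℕ}
    (hb : 1 ≤ b) (π : List ℕ) : IsCanonicalSeq (swap k T p b π) ↔ IsCanonicalSeq π := by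
  rw [isCanonicalSeq_iff, isCanonicalSeq_iff]
  refine ⟨fun h => ?_, fun h => h.swap hp hb⟩
  have := h.swap (k := k) (T := T) hp hb
  rwa [swap_swap hT] at this

theorem _root_.IsCanonicalSeq.range_sublist {π : List ℕ} (h : IsCanonicalSeq π) :
    (List.range' 1 (π.foldr max 0)).Sublist π := by
  induction π using List.reverseRecOn with
  | nil => simp
  | append_singleton π y ih =>
    obtain ⟨h1, hy, hle⟩ := (isCanonicalSeq_concat π y).1 h
    have hm : (π ++ [y]).foldr max 0 = max (π.foldr max 0) y := by
      clear h ih h1 hle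
      induction π with
      | nil => simp
      | cons z π ih => rw [List.cons_append, List.foldr_cons, List.foldr_cons, ih, max_assoc]
    rw [hm]
    rcases hle.lt_or_eq with hlt | rfl
    · rw [max_eq_left (by omega)]
      exact (ih h1).trans (List.sublist_append_left _ _)
    · rw [max_eq_right (by omega), List.range'_concat]
      refine (ih h1).append ?_
      simp [Nat.add_comm]

theorem _root_.IsCanonicalSeq.of_append {π ρ : List ℕ} (h : IsCanonicalSeq (π ++ ρ)) :
    IsCanonicalSeq π := by
  induction ρ using List.reverseRecOn with
  | nil => simpa using h
  | append_singleton ρ y ih =>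
    rw [← List.append_assoc, isCanonicalSeq_concat] at h
    exact ih h.1

theorem _root_.IsCanonicalSeq.le_length {π : List ℕ} (h : IsCanonicalSeq π) {x : ℕ} (hx : x ∈ π) :
    x ≤ π.length := by
  have := h.range_sublist.length_le
  rw [List.length_range'] at this
  exact (le_foldr_max hx).trans this

theorem containsPat_iff (π σ : List ℕ) :
    ContainsPat π σ ↔
      ∃ g : ℕ → ℕ, StrictMonoOn g {x | x ∈ σ} ∧ (σ.map g).Sublist π := by
  constructor
  · rintro ⟨f, hf, h⟩
    have heq : ∀ i j, σ.get i = σ.get j → π.get (f i) = π.get (f j) := by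
      intro i j hij
      have h1 := h i j
      have h2 := h j i
      omega
    have hidx : ∀ x : ℕ, ∃ v, ∀ i, σ.get i = x → π.get (f i) = v := by
      intro x
      by_cases hx : ∃ j, σ.get j = x
      · obtain ⟨j, rfl⟩ := hx
        exact ⟨_, fun i hi => heq i j hi⟩
      · exact ⟨0, fun i hi => absurd ⟨i, hi⟩ hx⟩
    choose g hg using hidx
    refine ⟨g, ?_, ?_⟩
    · intro x hx y hy hxy
      obtain ⟨i, rfl⟩ := List.get_of_mem hx
      obtain ⟨j, rfl⟩ := List.get_of_mem hy
      rw [← hg _ i rfl, ← hg _ j rfl]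
      exact (h i j).1 hxy
    · rw [List.sublist_iff_exists_fin_orderEmbedding_get_eq]
      refine ⟨OrderEmbedding.ofStrictMono (fun i => f (Fin.cast (by simp) i)) ?_, ?_⟩
      · intro i j hij
        exact hf hij
      · intro i
        have := hg _ (Fin.cast (by simp) i) rfl
        simp at this ⊢
        exact this.symm
  · rintro ⟨g, hg, hs⟩
    obtain ⟨f, hf⟩ := List.sublist_iff_exists_fin_orderEmbedding_get_eq.1 hs
    refine ⟨fun i => f (Fin.cast (by simp) i), fun i j hij => f.strictMono hij, fun i j => ?_⟩
    rw [← hf, ← hf]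
    simp only [List.get_eq_getElem, List.getElem_map, Fin.val_cast]
    exact (hg.lt_iff_lt (List.getElem_mem _) (List.getElem_mem _)).symm

theorem mem_iota {k x : ℕ} : x ∈ iota k ↔ 1 ≤ x ∧ x ≤ k := by
  simp only [iota, List.mem_map, List.mem_range]
  exact ⟨fun ⟨y, hy, e⟩ => by omega, fun h => ⟨x - 1, by omega, by omega⟩⟩

theorem iota_sorted (k : ℕ) : (iota k).Pairwise (· < ·) := by
  rw [iota, List.pairwise_map]
  exact List.pairwise_lt_range.imp fun h => Nat.add_lt_add_right h 1

theorem Admissible.iota_sublist {b : ℕ} {a : ℕ → ℕ} (ha : Admissible k b a) {D E : List ℕ}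
    (h : IsCanonicalSeq (D ++ b :: E)) : ((iota k).map a).Sublist D := by
  have h' : IsCanonicalSeq (D ++ [b]) := by
    refine IsCanonicalSeq.of_append (ρ := E) ?_
    simpa using h
  obtain ⟨h1, -, h2⟩ := (isCanonicalSeq_concat D b).1 h'
  refine List.Sublist.trans ?_ h1.range_sublist
  have hs : ((iota k).map a).Pairwise (· < ·) := by
    rw [List.pairwise_map]
    exact (iota_sorted k).imp_of_mem fun hx hy hxy => ha.1 (mem_iota.1 hx) (mem_iota.1 hy) hxy
  refine List.sublist_of_subperm_of_pairwise ?_ hs List.pairwise_lt_range'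
  refine hs.nodup.subperm ?_
  intro x hx
  obtain ⟨y, hy, rfl⟩ := List.mem_map.1 hx
  have := ha.2 y (mem_iota.1 hy)
  rw [List.mem_range'_1]
  omega

theorem containsPat_iff_occurs (hT : ∀ x ∈ T, 1 ≤ x ∧ x ≤ k) {u : ℕ} (hu : 1 ≤ u) (v : ℕ)
    {π : List ℕ} (h : IsCanonicalSeq π) :
    ContainsPat π
        (iota k ++ (List.replicate u (k + 1) ++ (k + 2) :: List.replicate v (k + 1)) ++ T) ↔
      ∃ b, 1 ≤ b ∧ b ≤ π.length ∧ Occurs k T u v b π := by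
  have hu0 : u ≠ 0 := by omega
  rw [containsPat_iff]
  constructor
  · rintro ⟨g, hg, hs⟩
    have hpos : ∀ x ∈ π, 1 ≤ x := ((isCanonicalSeq_iff π).1 h).1
    simp only [List.map_append, List.map_cons, List.map_replicate, List.append_assoc] at hs
    have hmem : ∀ x, 1 ≤ x → x ≤ k + 2 → x ∈ iota k ++
        (List.replicate u (k + 1) ++ (k + 2) :: List.replicate v (k + 1)) ++ T := by
      intro x h1 h2
      simp only [List.mem_append, mem_iota, List.mem_cons, List.mem_replicate]
      omega
    have hb : g (k + 1) ∈ π := hs.subset (by simp [hu0])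
    refine ⟨g (k + 1), hpos _ hb, h.le_length hb, g (k + 2),
      hg (hmem _ (by omega) (by omega)) (hmem _ (by omega) (by omega)) (by omega), g,
      ⟨?_, ?_⟩, ?_⟩
    · intro x hx y hy hxy
      exact hg (hmem x hx.1 (by have := hx.2; omega)) (hmem y hy.1 (by have := hy.2; omega)) hxy
    · intro i hi
      have hi1 := hi.1
      have hi2 := hi.2
      refine ⟨hpos _ (hs.subset ?_),
        hg (hmem i hi1 (by omega)) (hmem _ (by omega) (by omega)) (by omega)⟩
      exact List.mem_append_left _ (List.mem_map_of_mem (mem_iota.2 hi))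
    · refine List.Sublist.trans ?_ hs
      simp
  · rintro ⟨b, -, -, x, hx, a, ha, hs⟩
    refine ⟨fun y => if y ≤ k then a y else if y = k + 1 then b else x, ?_, ?_⟩
    · intro y hy z hz hyz
      have hmem : ∀ w ∈ iota k ++
          (List.replicate u (k + 1) ++ (k + 2) :: List.replicate v (k + 1)) ++ T,
          1 ≤ w ∧ w ≤ k + 2 := by
        intro w hw
        simp only [List.mem_append, mem_iota, List.mem_cons, List.mem_replicate] at hw
        rcases hw with (hw | hw | hw | hw) | hw
        · omega
        · omega
        · omega
        · omega
        · have := hT w hw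
          omega
      have hy' := hmem y hy
      have hz' := hmem z hz
      by_cases h1 : z ≤ k
      · have : y ≤ k := by omega
        simp only [if_pos h1, if_pos this]
        exact ha.1 ⟨hy'.1, this⟩ ⟨hz'.1, h1⟩ hyz
      · by_cases h2 : y ≤ k
        · have := (ha.2 y ⟨hy'.1, h2⟩).2
          simp only [if_neg h1, if_pos h2]
          split_ifs <;> omega
        · have h3 : y = k + 1 := by omega
          have h4 : ¬ z = k + 1 := by omega
          simp [h1, h3, h4, hx]
    · have e1 : (iota k).map (fun y => if y ≤ k then a y else if y = k + 1 then b else x) =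
          (iota k).map a :=
        List.map_congr_left fun y hy => if_pos (mem_iota.1 hy).2
      have e2 : T.map (fun y => if y ≤ k then a y else if y = k + 1 then b else x) = T.map a :=
        List.map_congr_left fun y hy => if_pos (hT y hy).2
      rw [List.map_append, List.map_append, e1, e2]
      obtain ⟨u, rfl⟩ : ∃ u', u = u' + 1 := ⟨u - 1, by omega⟩
      simp only [List.replicate_succ, List.cons_append] at hs
      obtain ⟨D, E, rfl, hbD, hE⟩ := List.cons_sublist_iff.1 hs
      obtain ⟨D₁, D₂, rfl⟩ := List.append_of_mem hbD
      have hi := ha.iota_sublist (D := D₁) (E := D₂ ++ E) (by simpa using h)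
      have hbE : [b].Sublist (b :: D₂) := by simp
      have := (hi.append hbE).append hE
      simpa [List.replicate_succ] using this

/-- Canonical sequences avoiding the second pattern at the levels below `j` and the first
pattern at the remaining levels. -/
def hybrid (k : ℕ) (T : List ℕ) (p q n j : ℕ) : Set (List ℕ) :=
  {π | π.length = n ∧ IsCanonicalSeq π ∧ ∀ b, 1 ≤ b → b ≤ n →
    (b ≤ j → ¬ Occurs k T (p + q) 0 b π) ∧ (j < b → ¬ Occurs k T p q b π)}

theorem mem_hybrid_swap (hT : ∀ x ∈ T, 1 ≤ x ∧ x ≤ k) {p : ℕ} (hp : 1 ≤ p) (q n j : ℕ)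
    (π : List ℕ) : swap k T p (j + 1) π ∈ hybrid k T p q n (j + 1) ↔ π ∈ hybrid k T p q n j := by
  simp only [hybrid, Set.mem_ofPred_eq]
  rw [length_swap, isCanonicalSeq_swap hT hp (by omega)]
  refine and_congr_right fun _ => and_congr_right fun _ => ?_
  refine forall_congr' fun b => forall_congr' fun _ => forall_congr' fun _ => ?_
  by_cases hb : b = j + 1
  · subst hb
    rw [occurs_swap_same hT]
    simp
  · rw [occurs_swap_of_ne hT _ _ _ hb, occurs_swap_of_ne hT _ _ _ hb,
      show b ≤ j + 1 ↔ b ≤ j by omega, show j + 1 < b ↔ j < b by omega]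

theorem ncard_hybrid (hT : ∀ x ∈ T, 1 ≤ x ∧ x ≤ k) {p : ℕ} (hp : 1 ≤ p) (q n j : ℕ) :
    (hybrid k T p q n j).ncard = (hybrid k T p q n 0).ncard := by
  induction j with
  | zero => rfl
  | succ j ih =>
    rw [← ih]
    have hinv : Function.Involutive (swap k T p (j + 1)) := swap_swap hT p (j + 1)
    have e : hybrid k T p q n (j + 1) = swap k T p (j + 1) '' hybrid k T p q n j := by
      rw [hinv.image_eq_preimage_symm]
      ext π
      rw [Set.mem_preimage, ← mem_hybrid_swap hT hp q n j, hinv]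
    rw [e, Set.ncard_image_of_injective _ hinv.injective]

theorem hybrid_zero (hT : ∀ x ∈ T, 1 ≤ x ∧ x ≤ k) {p : ℕ} (hp : 1 ≤ p) (q n : ℕ) :
    hybrid k T p q n 0 = {π : List ℕ | π.length = n ∧ IsCanonicalSeq π ∧ AvoidsPat π
      (iota k ++ (List.replicate p (k + 1) ++ (k + 2) :: List.replicate q (k + 1)) ++ T)} := by
  ext π
  refine and_congr_right fun hn => and_congr_right fun hc => ?_
  rw [AvoidsPat, containsPat_iff_occurs hT hp q hc, hn]
  push Not
  refine forall_congr' fun b => forall_congr' fun hb => forall_congr' fun _ => ?_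
  exact ⟨fun h => h.2 hb, fun h => ⟨fun h0 => by omega, fun _ => h⟩⟩

theorem hybrid_self (hT : ∀ x ∈ T, 1 ≤ x ∧ x ≤ k) {p : ℕ} (hp : 1 ≤ p) (q n : ℕ) :
    hybrid k T p q n n = {π : List ℕ | π.length = n ∧ IsCanonicalSeq π ∧ AvoidsPat π
      (iota k ++ (List.replicate (p + q) (k + 1) ++ [k + 2]) ++ T)} := by
  ext π
  refine and_congr_right fun hn => and_congr_right fun hc => ?_
  have h := containsPat_iff_occurs hT (show 1 ≤ p + q by omega) 0 hc
  rw [List.replicate_zero] at h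
  rw [AvoidsPat, h, hn]
  push Not
  refine forall_congr' fun b => forall_congr' fun _ => forall_congr' fun hb => ?_
  exact ⟨fun h => h.1 hb, fun h => ⟨fun _ => h, fun h0 => by omega⟩⟩

end PatternPartition

/-- For k ≥ 1, a sequence T over {1,…,k}, p ≥ 1 and q ≥ 0,
the pattern 1…k((1^p21^q)+k)T is equivalent to 1…k((1^(p+q)2)+k)T. -/
theorem statement12 (k : ℕ) (hk : 1 ≤ k) (T : List ℕ)
    (hT : ∀ x ∈ T, 1 ≤ x ∧ x ≤ k) (p q : ℕ) (hp : 1 ≤ p) :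
    PatEquiv
      (iota k ++ (List.replicate p (k + 1) ++ (k + 2) :: List.replicate q (k + 1)) ++ T)
      (iota k ++ (List.replicate (p + q) (k + 1) ++ [k + 2]) ++ T) := by
  intro n
  rw [pAvoid, pAvoid, ← PatternPartition.hybrid_zero hT hp, ← PatternPartition.hybrid_self hT hp,
    PatternPartition.ncard_hybrid hT hp q n n]
end
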